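/- arXiv:2605.11288 — 3 statements merged into one kernel-verified Lean document; each statement's English description precedes it below -/
import Mathlib

section
/- For every real δ with 0 < δ ≤ 1 there exist ε > 0 and n₀ ∈ ℕ such that the following holds. Let G be a graph on n ≥ n₀ vertices with minimum degree δ(G) ≥ n^{1−ε}, and let k be an integer with 1 ≤ k ≤ n^{1−δ}. If G contains a 2-factor consisting of at most k cycles, then G contains a 2-factor consisting of exactly k cycles. -/
/-- `H` is a 2-factor of `G`: a spanning 2-regular subgraph of `G`
(viewed as a graph on the same vertex set). -/
def IsTwoFactor {V : Type*} (G H : SimpleGraph V) : Prop :=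
  H ≤ G ∧ ∀ v : V, (H.neighborSet v).ncard = 2

/-- The number of cycles of a 2-factor, i.e. its number of connected components. -/
noncomputable def numCycles {V : Type*} (H : SimpleGraph V) : ℕ :=
  Nat.card H.ConnectedComponent

/-- The number of cycles of a permutation, fixed points included. -/
noncomputable def Equiv.Perm.cycleCount {V : Type*} (f : Equiv.Perm V) : ℕ :=
  Nat.card (Quotient (Equiv.Perm.SameCycle.setoid f))

namespace Equiv.Perm

variable {V : Type*}

theorem SameCycle.apply_eq_of_invariant {W : Type*} {f : Perm V} {g : V → W}
    (h : ∀ v, g (f v) = g v) {u v : V} (huv : f.SameCycle u v) : g u = g v := by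
  obtain ⟨j, rfl⟩ := huv
  induction j with
  | zero => simp
  | succ j ih => rw [ih, add_comm, zpow_add, mul_apply, zpow_one, h]
  | pred j ih =>
    rw [ih, ← h ((f ^ (-j - 1 : ℤ)) u), ← mul_apply, ← zpow_one_add]
    congr 3
    ring

theorem SameCycle.mono {f g : Perm V} (h : ∀ v, g.SameCycle v (f v)) {u v : V}
    (huv : f.SameCycle u v) : g.SameCycle u v :=
  Quotient.exact (s := SameCycle.setoid g) <|
    huv.apply_eq_of_invariant (g := Quotient.mk (SameCycle.setoid g))
      fun v => (Quotient.sound (h v)).symm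

theorem cycleCount_le_of_sameCycle [Finite V] {f g : Perm V} (h : ∀ v, g.SameCycle v (f v)) :
    g.cycleCount ≤ f.cycleCount := by
  refine Nat.card_le_card_of_surjective
    (Quotient.map' (s₁ := SameCycle.setoid f) (s₂ := SameCycle.setoid g) id
      fun _ _ huv => huv.mono h) ?_
  rintro ⟨v⟩
  exact ⟨Quotient.mk _ v, rfl⟩

theorem cycleCount_lt_of_sameCycle [Finite V] {f g : Perm V} (h : ∀ v, g.SameCycle v (f v))
    {x y : V} (hf : ¬ f.SameCycle x y) (hg : g.SameCycle x y) :
    g.cycleCount < f.cycleCount := by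
  set φ := Quotient.map' (s₁ := SameCycle.setoid f) (s₂ := SameCycle.setoid g) id
      fun _ _ huv => huv.mono h with hφ
  have hs : Function.Surjective φ := by
    rintro ⟨v⟩
    exact ⟨Quotient.mk _ v, rfl⟩
  refine lt_of_le_of_ne (Nat.card_le_card_of_surjective φ hs) fun he => hf ?_
  have hb := (Nat.bijective_iff_surjective_and_card φ).2 ⟨hs, he.symm⟩
  exact Quotient.exact (s := SameCycle.setoid f) (hb.1 (Quotient.sound hg))

theorem cycleCount_le_mul_swap [Finite V] [DecidableEq V] (f : Perm V) (x y : V) :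
    f.cycleCount ≤ (f * swap x y).cycleCount + 1 := by
  classical
  set s := SameCycle.setoid f
  let c : Quotient s → Quotient s := fun q => if q = Quotient.mk s y then Quotient.mk s x else q
  have hmk : ∀ v, Quotient.mk s (f v) = Quotient.mk s v := fun v =>
    Quotient.sound (show f.SameCycle (f v) v from (sameCycle_apply_left).2 (SameCycle.refl f v))
  have hc : ∀ v, c (Quotient.mk s ((f * swap x y) v)) = c (Quotient.mk s v) := by
    intro v
    rw [mul_apply, hmk]
    rcases eq_or_ne v x with rfl | hx
    · simp +contextual [c]
    rcases eq_or_ne v y with rfl | hy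
    · simp +contextual [c]
    rw [swap_apply_of_ne_of_ne hx hy]
  let φ : Option (Quotient (SameCycle.setoid (f * swap x y))) → Quotient s := fun o =>
    o.elim (Quotient.mk s y)
      (Quotient.lift (fun v => c (Quotient.mk s v)) fun _ _ h =>
        SameCycle.apply_eq_of_invariant (g := fun v => c (Quotient.mk s v)) hc h)
  have hφ : Function.Surjective φ := by
    intro q
    by_cases hq : q = Quotient.mk s y
    · exact ⟨none, hq.symm⟩
    · obtain ⟨v, rfl⟩ := Quotient.exists_rep q
      exact ⟨some (Quotient.mk _ v), if_neg hq⟩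
  simpa [cycleCount, Finite.card_option] using Nat.card_le_card_of_surjective φ hφ

theorem mul_swap_cycleCount_le [Finite V] [DecidableEq V] (f : Perm V) (x y : V) :
    (f * swap x y).cycleCount ≤ f.cycleCount + 1 := by
  simpa [mul_assoc] using cycleCount_le_mul_swap (f * swap x y) x y

theorem pow_apply_eq_pow_apply {f g : Perm V} {v : V} (j : ℕ)
    (h : ∀ i < j, g ((f ^ i) v) = f ((f ^ i) v)) : (g ^ j) v = (f ^ j) v := by
  induction j with
  | zero => rfl
  | succ j ih =>
    rw [pow_succ', pow_succ', mul_apply, mul_apply, ih fun i hi => h i (by omega), h j (by omega)]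

theorem mul_swap_cycleCount_lt [Finite V] [DecidableEq V] {f : Perm V} {x y : V}
    (h : ¬ f.SameCycle x y) : (f * swap x y).cycleCount < f.cycleCount := by
  classical
  set g := f * swap x y with hg
  have hgx : g x = f y := by simp [hg]
  have hgy : g y = f x := by simp [hg]
  have hgo : ∀ v, v ≠ x → v ≠ y → g v = f v := fun v hx hy => by
    simp [hg, swap_apply_of_ne_of_ne hx hy]
  have hfy : g.SameCycle (f y) y := by
    have hex : ∃ j : ℕ, (f ^ j) (f y) = y := by
      obtain ⟨j, hj⟩ := (sameCycle_apply_left.2 (SameCycle.refl f y)).exists_nat_pow_eq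
      exact ⟨j, hj⟩
    refine ⟨(Nat.find hex : ℕ), ?_⟩
    rw [zpow_natCast, pow_apply_eq_pow_apply, Nat.find_spec hex]
    intro i hi
    refine hgo _ (fun hx => h ?_) (Nat.find_min hex hi)
    rw [← hx]
    exact (sameCycle_pow_left.2 (sameCycle_apply_left.2 (SameCycle.refl f y)))
  have hxy : g.SameCycle x y := by
    refine SameCycle.trans ?_ hfy
    rw [← hgx]
    exact sameCycle_apply_right.2 (SameCycle.refl g x)
  refine cycleCount_lt_of_sameCycle (fun v => ?_) h hxy
  rcases eq_or_ne v x with rfl | hx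
  · rw [← hgy]
    exact sameCycle_apply_right.2 hxy
  rcases eq_or_ne v y with rfl | hy
  · rw [← hgx]
    exact sameCycle_apply_right.2 hxy.symm
  rw [← hgo v hx hy]
  exact sameCycle_apply_right.2 (SameCycle.refl g v)

end Equiv.Perm

/-- A cyclic orientation of a 2-regular graph: `f v` is the successor of `v`. -/
def IsOrientation {V : Type*} (H : SimpleGraph V) (f : Equiv.Perm V) : Prop :=
  (∀ v w, H.Adj v w ↔ f v = w ∨ f w = v) ∧ ∀ v, f (f v) ≠ v

theorem IsOrientation.numCycles_eq {V : Type*} {H : SimpleGraph V} {f : Equiv.Perm V}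
    (h : IsOrientation H f) : numCycles H = f.cycleCount := by
  have key : ∀ v w, H.Reachable v w ↔ f.SameCycle v w := by
    intro v w
    constructor
    · rintro ⟨p⟩
      induction p with
      | nil => exact .refl _ _
      | cons hadj _ ih =>
        refine .trans ?_ ih
        rcases (h.1 _ _).1 hadj with rfl | rfl
        · exact Equiv.Perm.sameCycle_apply_right.2 (.refl _ _)
        · exact Equiv.Perm.sameCycle_apply_left.2 (.refl _ _)
    · intro hs
      have := hs.apply_eq_of_invariant (g := H.connectedComponentMk) fun v =>
        SimpleGraph.ConnectedComponent.sound (SimpleGraph.Adj.reachable ((h.1 _ _).2 (.inr rfl)))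
      exact SimpleGraph.ConnectedComponent.exact this
  exact Nat.card_congr (Quot.congr (Equiv.refl V) key)

theorem IsOrientation.ncard_neighborSet {V : Type*} {H : SimpleGraph V} {f : Equiv.Perm V}
    (h : IsOrientation H f) (v : V) : (H.neighborSet v).ncard = 2 := by
  have : H.neighborSet v = {f v, f.symm v} := by
    ext w
    simp [h.1, eq_comm, Equiv.eq_symm_apply]
  rw [this, Set.ncard_pair]
  intro he
  exact h.2 v (by rw [he, Equiv.apply_symm_apply])

theorem exists_isOrientation_of_perm {V : Type*} (f : Equiv.Perm V) (hf : ∀ v, f (f v) ≠ v) :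
    ∃ H : SimpleGraph V, IsOrientation H f := by
  refine ⟨{ Adj := fun v w => f v = w ∨ f w = v, symm := ⟨fun v w => Or.symm⟩, loopless := ⟨?_⟩ },
    fun v w => Iff.rfl, hf⟩
  rintro v (h | h) <;> exact hf v (by rw [h, h])

theorem exists_isOrientation {V : Type*} [Finite V] (H : SimpleGraph V)
    (hH : ∀ v, (H.neighborSet v).ncard = 2) : ∃ f : Equiv.Perm V, IsOrientation H f := by
  have hne : ∀ v, (H.neighborSet v).Nonempty := fun v =>
    (Set.ncard_pos (Set.toFinite _)).1 (by rw [hH]; norm_num)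
  have hcyc : H.IsCycles := fun v _ => hH v
  have hwalk : ∀ C : H.ConnectedComponent, ∃ (u : V) (p : H.Walk u u), p.IsCycle ∧
      p.toSubgraph.verts = C.supp := by
    intro C
    obtain ⟨u, hu⟩ := C.nonempty_supp
    exact ⟨u, hcyc.exists_cycle_toSubgraph_verts_eq_connectedComponentSupp hu (hne u)⟩
  choose u p hp hverts using hwalk
  have hidx : ∀ v, ∃ i, i < (p (H.connectedComponentMk v)).length ∧
      (p (H.connectedComponentMk v)).getVert i = v := by
    intro v
    set C := H.connectedComponentMk v
    have hv : v ∈ (p C).support := by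
      rw [← SimpleGraph.Walk.mem_verts_toSubgraph, hverts]
      rfl
    obtain ⟨i, hi, hil⟩ := SimpleGraph.Walk.mem_support_iff_exists_getVert.1 hv
    rcases hil.lt_or_eq with h | h
    · exact ⟨i, h, hi⟩
    · refine ⟨0, by have := (hp C).three_le_length; omega, ?_⟩
      rw [← hi, h]
      simp
  choose idx hlt hget using hidx
  let g : V → V := fun v => (p (H.connectedComponentMk v)).getVert (idx v + 1)
  have hadj : ∀ v, H.Adj v (g v) := by
    intro v
    have := (p (H.connectedComponentMk v)).adj_getVert_succ (hlt v)
    rwa [hget v] at this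
  have hcomp : ∀ v, H.connectedComponentMk (g v) = H.connectedComponentMk v := fun v =>
    SimpleGraph.ConnectedComponent.sound (hadj v).reachable.symm
  have hinj : Function.Injective g := by
    intro v w hvw
    have hC : H.connectedComponentMk v = H.connectedComponentMk w := by
      rw [← hcomp v, hvw, hcomp w]
    have h1 := hlt v
    have h2 := hget v
    have h3 : g v = (p (H.connectedComponentMk v)).getVert (idx v + 1) := rfl
    rw [hC] at h1 h2 h3
    have := (hp (H.connectedComponentMk w)).getVert_injOn (x₁ := idx v + 1) (x₂ := idx w + 1)
      ⟨by omega, by omega⟩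
      ⟨by omega, by have := hlt w; omega⟩ (by rw [← h3, hvw])
    have hidx : idx v = idx w := by omega
    exact h2.symm.trans ((congrArg _ hidx).trans (hget w))
  have hgg : ∀ v, g (g v) ≠ v := by
    intro v hv
    have h1 := hlt (g v)
    have h2 := hget (g v)
    have h3 : g (g v) = (p (H.connectedComponentMk (g v))).getVert (idx (g v) + 1) := rfl
    rw [hcomp v] at h1 h2 h3
    set q := p (H.connectedComponentMk v)
    have hq := hp (H.connectedComponentMk v)
    have h3l : 3 ≤ q.length := hq.three_le_length
    have hvl : idx v < q.length := hlt v
    have hg : g v = q.getVert (idx v + 1) := rfl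
    rw [hv] at h3
    have e0 : q.getVert q.length = q.getVert 0 := by simp
    have e1 : ∀ i j, 1 ≤ i → i ≤ q.length → 1 ≤ j → j ≤ q.length → q.getVert i = q.getVert j →
        i = j := fun i j a b c d e => hq.getVert_injOn ⟨a, b⟩ ⟨c, d⟩ e
    have hv' := hget v
    rcases Nat.eq_zero_or_pos (idx (g v)) with hz | hz
    · have a := e1 _ q.length (by omega) (by omega) (by omega) le_rfl
        (hg.symm.trans (h2.symm.trans (by rw [hz, e0])))
      have b := e1 _ (idx v) (by omega) (by omega) (by omega) (by omega)
        (h3.symm.trans hv'.symm)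
      omega
    · have a := e1 _ _ (by omega) (by omega) (by omega) (by omega) (h2.trans hg)
      rcases Nat.eq_zero_or_pos (idx v) with hy | hy
      · have b := e1 _ q.length (by omega) (by omega) (by omega) le_rfl
          (h3.symm.trans (hv'.symm.trans (by rw [hy, e0])))
        omega
      · have b := e1 _ _ (by omega) (by omega) (by omega) (by omega) (h3.symm.trans hv'.symm)
        omega
  refine ⟨Equiv.ofBijective g (Finite.injective_iff_bijective.1 hinj), fun v w => ?_, hgg⟩
  have hsurj := Finite.injective_iff_surjective.1 hinj
  simp only [Equiv.ofBijective_apply]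
  refine ⟨fun hvw => ?_, ?_⟩
  · obtain ⟨x, rfl⟩ := hsurj v
    have hsub : ({g (g x), x} : Set V) ⊆ H.neighborSet (g x) := by
      rintro y (rfl | rfl)
      · exact hadj _
      · exact (hadj _).symm
    have heq := Set.eq_of_subset_of_ncard_le hsub (by rw [hH, Set.ncard_pair (hgg x)])
      (Set.toFinite _)
    have : w ∈ ({g (g x), x} : Set V) := heq ▸ hvw
    rcases this with h | h
    · exact .inl h.symm
    · exact .inr (congrArg g h)
  · rintro (rfl | rfl)
    · exact hadj _
    · exact (hadj _).symm

theorem exists_eq_of_update_not_le {ι : Type*} [Finite ι] [DecidableEq ι] (g : (ι → Bool) → ℕ)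
    (hg : ∀ b i, g (Function.update b i (!b i)) ≤ g b + 1) {b₀ b₁ : ι → Bool} {k : ℕ}
    (h₀ : g b₀ ≤ k) (h₁ : k ≤ g b₁) : ∃ b, g b = k := by
  classical
  have := Fintype.ofFinite ι
  have key : ∀ S : Finset ι, k ≤ g (fun i => if i ∈ S then b₁ i else b₀ i) → ∃ b, g b = k := by
    intro S
    induction S using Finset.induction_on with
    | empty => exact fun h => ⟨b₀, le_antisymm h₀ (by simpa using h)⟩
    | insert a S ha ih =>
      intro h
      by_cases hk : k ≤ g (fun i => if i ∈ S then b₁ i else b₀ i)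
      · exact ih hk
      set b : ι → Bool := fun i => if i ∈ S then b₁ i else b₀ i with hb
      have hupd : (fun i => if i ∈ insert a S then b₁ i else b₀ i) =
          Function.update b a (b₁ a) := by
        funext i
        rcases eq_or_ne i a with rfl | hi
        · simp
        · simp [hi, hb]
      rw [hupd] at h
      by_cases hba : b₁ a = b a
      · rw [hba, Function.update_eq_self] at h
        exact absurd h hk
      · have hflip : b₁ a = !b a := by
          cases h1 : b₁ a <;> cases h2 : b a <;> simp_all
        rw [hflip] at h
        have := hg b a
        exact ⟨_, le_antisymm (by omega) h⟩
  exact key Finset.univ (by simpa using h₁)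

/-- The point reached from `base p.1` after `len p.1` steps of `f` if `p.2` is true, and
`base p.1` itself otherwise. -/
def pairPoint {V ι : Type*} (f : Equiv.Perm V) (base : ι → V) (len : ι → ℕ) (p : ι × Bool) : V :=
  (f ^ (bif p.2 then len p.1 else 0)) (base p.1)

/-- Well separated pairs of vertices, each lying on a cycle of the permutation `f`, together with
a permutation `next` of the pairs such that all edges needed to reroute `f` from a pair to the
successors of the next pair are present in `G`. -/
structure PairSystem {V : Type*} (G : SimpleGraph V) (f : Equiv.Perm V) (ι : Type*) where
  base : ι → V
  len : ι → ℕ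
  next : Equiv.Perm ι
  bound : ℕ
  three_le_len : ∀ i, 3 ≤ len i
  len_le : ∀ i, len i ≤ bound
  separated : ∀ i i' (j : ℤ), |j| ≤ 2 * bound → (f ^ j) (base i) = base i' → i = i' ∧ j = 0
  adj : ∀ i s t, G.Adj (pairPoint f base len (i, s)) (f (pairPoint f base len (next i, t)))

namespace PairSystem

variable {V ι : Type*} {G : SimpleGraph V} {f : Equiv.Perm V} (P : PairSystem G f ι)

def point (p : ι × Bool) : V := pairPoint f P.base P.len p

def offset (p : ι × Bool) : ℕ := bif p.2 then P.len p.1 else 0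

theorem point_eq (p : ι × Bool) : P.point p = (f ^ P.offset p) (P.base p.1) := rfl

theorem offset_le (p : ι × Bool) : P.offset p ≤ P.bound := by
  rcases p with ⟨i, _ | _⟩
  · exact Nat.zero_le _
  · exact P.len_le i

theorem eq_of_zpow_point {p q : ι × Bool} {j : ℤ} (hj : |j| ≤ P.bound)
    (h : (f ^ j) (P.point p) = P.point q) : p.1 = q.1 ∧ j + P.offset p = P.offset q := by
  have hp := P.offset_le p
  have hq := P.offset_le q
  have : (f ^ (j + P.offset p - P.offset q)) (P.base p.1) = P.base q.1 := by
    rw [show j + P.offset p - P.offset q = -(P.offset q : ℤ) + (j + P.offset p) by ring,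
      zpow_add, zpow_add, Equiv.Perm.mul_apply, Equiv.Perm.mul_apply, zpow_natCast,
      ← P.point_eq, h, P.point_eq, zpow_neg, zpow_natCast, Equiv.Perm.inv_eq_iff_eq]
  obtain ⟨h1, h2⟩ := P.separated _ _ _ (by rw [abs_le] at *; constructor <;> omega) this
  exact ⟨h1, by omega⟩

theorem point_injective : Function.Injective P.point := by
  intro p q h
  obtain ⟨h1, h2⟩ := P.eq_of_zpow_point (p := p) (q := q) (j := 0) (by simp) (by simpa using h)
  rcases p with ⟨i, s⟩
  rcases q with ⟨i', t⟩
  obtain rfl : i = i' := h1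
  have := P.three_le_len i
  cases s <;> cases t <;> simp [offset] at h2 ⊢ <;> omega

theorem iterate_point_notMem (p : ι × Bool) {j : ℕ} (hj : 0 < j) (hj3 : j < 3) :
    (f ^ j) (P.point p) ∉ Set.range P.point := by
  rintro ⟨q, hq⟩
  have hb := P.len_le p.1
  have h3 := P.three_le_len p.1
  obtain ⟨h1, h2⟩ := P.eq_of_zpow_point (p := p) (q := q) (j := j) (by rw [Nat.abs_cast]; omega)
    (by rw [zpow_natCast, hq])
  rcases p with ⟨i, s⟩
  rcases q with ⟨i', t⟩
  obtain rfl : i = i' := h1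
  cases s <;> cases t <;> simp [offset] at h2 h3 <;> omega

theorem pow_base_notMem (i : ι) {j : ℕ} (hj : 0 < j) (hji : j < P.len i) :
    (f ^ j) (P.base i) ∉ Set.range P.point := by
  rintro ⟨q, hq⟩
  have hb := P.len_le i
  obtain ⟨h1, h2⟩ := P.eq_of_zpow_point (p := (i, false)) (q := q) (j := j)
    (by rw [Nat.abs_cast]; omega) (by rw [zpow_natCast, hq]; rfl)
  rcases q with ⟨i', t⟩
  obtain rfl : i = i' := h1
  cases t <;> simp [offset] at h2 <;> omega

/-- The permutation of the points moving the pair `i` to the pair `next i`, crosswise where `b i`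
holds. -/
def twist (b : ι → Bool) : Equiv.Perm (ι × Bool) where
  toFun p := (P.next p.1, p.2 ^^ b p.1)
  invFun p := (P.next.symm p.1, p.2 ^^ b (P.next.symm p.1))
  left_inv p := by simp
  right_inv p := by simp

/-- The permutation obtained from `f` by rerouting it along `P`. -/
noncomputable def reroute (b : ι → Bool) : Equiv.Perm V :=
  f * (P.twist b).viaEmbedding ⟨P.point, P.point_injective⟩

theorem reroute_point (b : ι → Bool) (p : ι × Bool) :
    P.reroute b (P.point p) = f (P.point (P.next p.1, p.2 ^^ b p.1)) :=
  congrArg f (Equiv.Perm.viaEmbedding_apply _ ⟨P.point, P.point_injective⟩ p)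

theorem reroute_of_notMem (b : ι → Bool) {v : V} (hv : v ∉ Set.range P.point) :
    P.reroute b v = f v :=
  congrArg f (Equiv.Perm.viaEmbedding_apply_of_notMem _ ⟨P.point, P.point_injective⟩ v hv)

theorem reroute_update [DecidableEq V] [DecidableEq ι] (b : ι → Bool) (i : ι) :
    P.reroute (Function.update b i (!b i)) =
      P.reroute b * Equiv.swap (P.point (i, false)) (P.point (i, true)) := by
  ext v
  rw [Equiv.Perm.mul_apply]
  by_cases hv : v ∈ Set.range P.point
  · obtain ⟨⟨i', s⟩, rfl⟩ := hv
    rcases eq_or_ne i' i with rfl | hi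
    · cases s <;> simp [reroute_point]
    · rw [Equiv.swap_apply_of_ne_of_ne (P.point_injective.ne (by simp [hi]))
        (P.point_injective.ne (by simp [hi]))]
      simp [reroute_point, hi]
  · rw [Equiv.swap_apply_of_ne_of_ne (fun h => hv ⟨_, h.symm⟩) (fun h => hv ⟨_, h.symm⟩),
      P.reroute_of_notMem _ hv, P.reroute_of_notMem _ hv]

theorem adj_reroute (hf : ∀ v, G.Adj v (f v)) (b : ι → Bool) (v : V) :
    G.Adj v (P.reroute b v) := by
  by_cases hv : v ∈ Set.range P.point
  · obtain ⟨p, rfl⟩ := hv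
    rw [reroute_point]
    exact P.adj _ _ _
  · rw [P.reroute_of_notMem _ hv]
    exact hf v

theorem reroute_reroute_ne (hf : ∀ v, f (f v) ≠ v) (b : ι → Bool) (v : V) :
    P.reroute b (P.reroute b v) ≠ v := by
  have h1 : ∀ p, f (P.point p) ∉ Set.range P.point := fun p => by
    simpa using P.iterate_point_notMem p one_pos (by norm_num)
  have h2 : ∀ p, f (f (P.point p)) ∉ Set.range P.point := fun p => by
    simpa [pow_two] using P.iterate_point_notMem p two_pos (by norm_num)
  by_cases hv : v ∈ Set.range P.point
  · obtain ⟨p, rfl⟩ := hv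
    rw [reroute_point, P.reroute_of_notMem _ (h1 _)]
    exact fun h => h2 _ ⟨p, h.symm⟩
  · rw [P.reroute_of_notMem _ hv]
    by_cases hfv : f v ∈ Set.range P.point
    · obtain ⟨p, hp⟩ := hfv
      rw [← hp, reroute_point]
      exact fun h => h2 _ ⟨p, by rw [h, hp]⟩
    · rw [P.reroute_of_notMem _ hfv]
      exact hf v

theorem reroute_pow_base (b : ι → Bool) (i : ι) :
    (P.reroute b).SameCycle (f (P.base i)) (P.point (i, true)) := by
  have h3 := P.three_le_len i
  refine ⟨(P.len i - 1 : ℕ), ?_⟩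
  have hpow : ∀ j, (f ^ j) (f (P.base i)) = (f ^ (j + 1)) (P.base i) := fun j => by
    rw [pow_succ, Equiv.Perm.mul_apply]
  rw [zpow_natCast, Equiv.Perm.pow_apply_eq_pow_apply, hpow, Nat.sub_add_cancel (by omega)]
  · rfl
  · intro j hj
    rw [hpow]
    exact P.reroute_of_notMem _ (P.pow_base_notMem i (by omega) (by omega))

theorem exists_reroute_cycleCount_le [Finite V] [Finite ι] :
    ∃ b, (P.reroute b).cycleCount ≤ f.cycleCount := by
  classical
  obtain ⟨b, hb⟩ := Finite.exists_min fun b => (P.reroute b).cycleCount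
  refine ⟨b, Equiv.Perm.cycleCount_le_of_sameCycle ?_⟩
  set g := P.reroute b with hg
  have hpair : ∀ i, g.SameCycle (P.point (i, false)) (P.point (i, true)) := by
    intro i
    by_contra h
    have := hb (Function.update b i (!b i))
    rw [P.reroute_update] at this
    exact absurd (Equiv.Perm.mul_swap_cycleCount_lt h) (not_lt.2 this)
  have hpair' : ∀ i s t, g.SameCycle (P.point (i, s)) (P.point (i, t)) := by
    rintro i (_ | _) (_ | _)
    · rfl
    · exact hpair i
    · exact (hpair i).symm
    · rfl
  have hnext : ∀ i s t, g.SameCycle (P.point (i, s)) (f (P.point (P.next i, t))) := by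
    intro i s t
    have h1 : g (P.point (i, t ^^ b i)) = f (P.point (P.next i, t)) := by
      rw [hg, reroute_point]
      simp
    rw [← h1]
    exact Equiv.Perm.sameCycle_apply_right.2 (hpair' _ _ _)
  intro v
  by_cases hv : v ∈ Set.range P.point
  · obtain ⟨⟨i, s⟩, rfl⟩ := hv
    obtain ⟨i, rfl⟩ := P.next.surjective i
    exact (hpair' _ _ true).trans <| (P.reroute_pow_base b _).symm.trans <|
      (hnext i false false).symm.trans (hnext i false s)
  · rw [← P.reroute_of_notMem b hv]
    exact Equiv.Perm.sameCycle_apply_right.2 (.refl _ _)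

theorem le_cycleCount_reroute [Finite V] {k : ℕ} (layer : ι → Fin k)
    (hsurj : Function.Surjective layer) (hnext : ∀ i, layer (P.next i) = layer i) :
    k ≤ (P.reroute fun _ => true).cycleCount := by
  classical
  set g := P.reroute fun _ => true with hg
  have hstep : ∀ i, ∀ j : ℕ, ∃ i' a, layer i' = layer i ∧ a < P.len i' ∧
      (g ^ j) (f (P.base i)) = (f ^ (a + 1)) (P.base i') := by
    intro i j
    induction j with
    | zero => exact ⟨i, 0, rfl, by have := P.three_le_len i; omega, by simp⟩
    | succ j ih =>
      obtain ⟨i', a, hl, ha, he⟩ := ih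
      rw [pow_succ', Equiv.Perm.mul_apply, he]
      rcases Nat.lt_or_ge (a + 1) (P.len i') with h | h
      · refine ⟨i', a + 1, hl, h, ?_⟩
        rw [hg, P.reroute_of_notMem _ (P.pow_base_notMem i' (by omega) h), pow_succ' f (a + 1)]
        rfl
      · refine ⟨P.next i', 0, by rw [hnext, hl], by have := P.three_le_len (P.next i'); omega, ?_⟩
        have : (f ^ (a + 1)) (P.base i') = P.point (i', true) := by
          rw [P.point_eq, show a + 1 = P.len i' by omega]
          rfl
        rw [this, hg, P.reroute_point]
        simp [point_eq, offset]
  choose r hr using hsurj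
  let φ : Fin k → Quotient (Equiv.Perm.SameCycle.setoid g) := fun c =>
    Quotient.mk _ (f (P.base (r c)))
  have hφ : Function.Injective φ := by
    intro c c' h
    have hs : g.SameCycle (f (P.base (r c))) (f (P.base (r c'))) :=
      Quotient.exact (s := Equiv.Perm.SameCycle.setoid g) h
    obtain ⟨j, hj⟩ := hs.exists_nat_pow_eq
    obtain ⟨i', a, hl, ha, he⟩ := hstep (r c) j
    rw [hj, pow_succ', Equiv.Perm.mul_apply] at he
    have he' := f.injective he
    have hb := P.len_le i'
    obtain ⟨h1, -⟩ := P.eq_of_zpow_point (p := (i', false)) (q := (r c', false)) (j := a)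
      (by rw [Nat.abs_cast]; omega) (by rw [zpow_natCast]; exact he'.symm)
    rw [← hr c, ← hl, ← hr c']
    exact congrArg layer h1
  simpa [Equiv.Perm.cycleCount] using Nat.card_le_card_of_injective φ hφ

theorem exists_reroute_cycleCount_eq [Finite V] [Finite ι] {k : ℕ} (layer : ι → Fin k)
    (hsurj : Function.Surjective layer) (hnext : ∀ i, layer (P.next i) = layer i)
    (hk : f.cycleCount ≤ k) : ∃ b, (P.reroute b).cycleCount = k := by
  classical
  obtain ⟨b, hb⟩ := P.exists_reroute_cycleCount_le
  refine exists_eq_of_update_not_le _ (fun b i => ?_) (hb.trans hk)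
    (P.le_cycleCount_reroute layer hsurj hnext)
  rw [P.reroute_update]
  exact Equiv.Perm.mul_swap_cycleCount_le _ _ _

end PairSystem

section Domination

open Finset

variable {X V : Type*} [Fintype X] [DecidableEq V] {R : X → X → Prop}
  [DecidableRel R] {cen : X → V} {D : ℕ}

theorem exists_card_mul_le_card_covered
    (hR : ∀ p, ∃ A : Finset V, 2 * D ≤ #A ∧ ∀ v ∈ A, ∃ q, cen q = v ∧ R p q) (hD : 0 < D)
    {B : Finset V} (hB : #B ≤ D) {U : Finset X} (hU : U.Nonempty) :
    ∃ q, cen q ∉ B ∧ #U * D ≤ #{p ∈ U | R p q} * Fintype.card X := by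
  by_contra! hcon
  set Q : Finset X := {q | cen q ∉ B}
  have hdeg : ∀ p, D ≤ #{q ∈ Q | R p q} := by
    intro p
    obtain ⟨A, hA, hAR⟩ := hR p
    have hsub : A \ B ⊆ image cen {q ∈ Q | R p q} := by
      intro v hv
      rw [mem_sdiff] at hv
      obtain ⟨q, rfl, hq⟩ := hAR v hv.1
      exact mem_image_of_mem _ (by simp [Q, hv.2, hq])
    have h1 := le_card_sdiff B A
    have h2 := (card_le_card hsub).trans card_image_le
    omega
  have hlow : #U * D ≤ ∑ q ∈ Q, #{p ∈ U | R p q} := by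
    calc #U * D = ∑ p ∈ U, D := by simp
      _ ≤ ∑ p ∈ U, #{q ∈ Q | R p q} := sum_le_sum fun p _ => hdeg p
      _ = ∑ q ∈ Q, #{p ∈ U | R p q} := by
        simp_rw [card_filter]
        exact sum_comm
  have hQ : Q.Nonempty := by
    obtain ⟨p, -⟩ := hU
    have := card_pos.1 (hD.trans_le (hdeg p))
    exact this.mono (filter_subset _ _)
  have hup : ∑ q ∈ Q, #{p ∈ U | R p q} * Fintype.card X < ∑ q ∈ Q, #U * D :=
    sum_lt_sum_of_nonempty hQ fun q hq => hcon q (by simpa [Q] using hq)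
  rw [← sum_mul, sum_const, smul_eq_mul] at hup
  have hQX : #Q ≤ Fintype.card X := card_le_univ Q
  have h1 := Nat.mul_le_mul_right (Fintype.card X) hlow
  have h2 := Nat.mul_le_mul_right (#U * D) hQX
  rw [mul_comm (#U * D)] at h1
  omega

variable [DecidableEq X] {C : V → Finset V} {β Θ : ℕ}

theorem exists_almost_dominating
    (hR : ∀ p, ∃ A : Finset V, 2 * D ≤ #A ∧ ∀ v ∈ A, ∃ q, cen q = v ∧ R p q) (hD : 0 < D)
    (hC : ∀ v w, v ∈ C w → w ∈ C v) (hβ : ∀ v, #(C v) ≤ β) (hΘ : Fintype.card X ≤ Θ * D)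
    (B : Finset V) (s : ℕ) (hB : #B + s * β ≤ D) :
    ∃ S : Finset X, #S ≤ s ∧ (∀ q ∈ S, cen q ∉ B) ∧
      (∀ q ∈ S, ∀ q' ∈ S, cen q ∈ C (cen q') → q = q') ∧
      #{p | ∀ q ∈ S, ¬ R p q} * Θ ^ s ≤ Fintype.card X * (Θ - 1) ^ s := by
  induction s with
  | zero => exact ⟨∅, by simp, by simp, by simp, by simp⟩
  | succ s ih =>
    rw [Nat.add_mul] at hB
    obtain ⟨S, hS, hSB, hSC, hSU⟩ := ih (by omega)
    set U : Finset X := {p | ∀ q ∈ S, ¬ R p q} with hUdef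
    rcases U.eq_empty_or_nonempty with hU | hU
    · exact ⟨S, by omega, hSB, hSC, by rw [← hUdef, hU]; simp⟩
    set B' := B ∪ S.biUnion fun q => C (cen q)
    have hB' : #B' ≤ D := by
      have h1 : #(S.biUnion fun q => C (cen q)) ≤ #S * β :=
        card_biUnion_le_card_mul _ _ _ fun q _ => hβ _
      have h2 : #B' ≤ #B + #(S.biUnion fun q => C (cen q)) := card_union_le _ _
      have h3 := Nat.mul_le_mul_right β hS
      omega
    obtain ⟨q, hq, hcov⟩ := exists_card_mul_le_card_covered hR hD hB' hU
    simp only [B', mem_union, mem_biUnion, not_or, not_exists, not_and] at hq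
    refine ⟨insert q S, (card_insert_le _ _).trans (by omega), ?_, ?_, ?_⟩
    · simpa using ⟨hq.1, hSB⟩
    · intro a ha b hb hab
      rcases mem_insert.1 ha with rfl | ha' <;> rcases mem_insert.1 hb with rfl | hb'
      · rfl
      · exact absurd hab (hq.2 b hb')
      · exact absurd (hC _ _ hab) (hq.2 a ha')
      · exact hSC a ha' b hb' hab
    · have hsplit : #{p ∈ U | R p q} + #{p | ∀ q' ∈ insert q S, ¬ R p q'} = #U := by
        rw [← card_filter_add_card_filter_not (s := U) (p := fun p => R p q)]
        congr 2
        ext p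
        simp [hUdef, and_comm]
      set a := #{p ∈ U | R p q}
      set u' := #{p | ∀ q' ∈ insert q S, ¬ R p q'}
      have hle : #U ≤ a * Θ := by
        refine Nat.le_of_mul_le_mul_right (hcov.trans ?_) hD
        rw [mul_assoc]
        exact Nat.mul_le_mul_left _ hΘ
      have hstep : u' * Θ ≤ #U * (Θ - 1) := by
        rw [Nat.mul_sub, mul_one, ← hsplit, Nat.add_mul]
        omega
      calc u' * Θ ^ (s + 1) = u' * Θ * Θ ^ s := by ring
        _ ≤ #U * (Θ - 1) * Θ ^ s := Nat.mul_le_mul_right _ hstep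
        _ = #U * Θ ^ s * (Θ - 1) := by ring
        _ ≤ Fintype.card X * (Θ - 1) ^ s * (Θ - 1) := Nat.mul_le_mul_right _ hSU
        _ = _ := by ring

theorem two_mul_pow_le_succ_pow (a : ℕ) (ha : 0 < a) : 2 * a ^ (a + 1) ≤ (a + 1) ^ (a + 1) := by
  have key : ∀ m : ℕ, a ^ m * (a + m) ≤ a * (a + 1) ^ m := by
    intro m
    induction m with
    | zero => simp
    | succ m ih =>
      calc a ^ (m + 1) * (a + (m + 1)) ≤ a ^ m * (a + m) * (a + 1) := by
            rw [pow_succ, mul_assoc, mul_assoc]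
            exact Nat.mul_le_mul_left _ (by nlinarith)
        _ ≤ a * (a + 1) ^ m * (a + 1) := Nat.mul_le_mul_right _ ih
        _ = _ := by ring
  refine Nat.le_of_mul_le_mul_left (le_trans ?_ (key (a + 1))) ha
  calc a * (2 * a ^ (a + 1)) = a ^ (a + 1) * (2 * a) := by ring
    _ ≤ _ := Nat.mul_le_mul_left _ (by omega)

theorem exists_dominating
    (hR : ∀ p, ∃ A : Finset V, 2 * D ≤ #A ∧ ∀ v ∈ A, ∃ q, cen q = v ∧ R p q) (hD : 0 < D)
    (hC : ∀ v w, v ∈ C w → w ∈ C v) (hβ : ∀ v, #(C v) ≤ β) (hΘ : Fintype.card X ≤ Θ * D)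
    (hΘ2 : 2 ≤ Θ) {t : ℕ} (ht : Fintype.card X < 2 ^ t) (B : Finset V)
    (hB : #B + Θ * t * β ≤ D) :
    ∃ S : Finset X, #S ≤ Θ * t ∧ (∀ q ∈ S, cen q ∉ B) ∧
      (∀ q ∈ S, ∀ q' ∈ S, cen q ∈ C (cen q') → q = q') ∧ ∀ p, ∃ q ∈ S, R p q := by
  obtain ⟨S, hS, hSB, hSC, hSU⟩ := exists_almost_dominating hR hD hC hβ hΘ B (Θ * t) hB
  refine ⟨S, hS, hSB, hSC, ?_⟩
  by_contra! hcon
  obtain ⟨p, hp⟩ := hcon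
  have hpos : 0 < #{p | ∀ q ∈ S, ¬ R p q} := card_pos.2 ⟨p, by simpa using hp⟩
  have h2 := two_mul_pow_le_succ_pow (Θ - 1) (by omega)
  rw [Nat.sub_add_cancel (by omega)] at h2
  have h3 : 2 ^ t * (Θ - 1) ^ (Θ * t) ≤ Θ ^ (Θ * t) := by
    rw [pow_mul, pow_mul, ← mul_pow]
    exact Nat.pow_le_pow_left h2 t
  have h4 : 0 < (Θ - 1) ^ (Θ * t) := pow_pos (by omega) _
  have h5 := Nat.mul_lt_mul_of_pos_right ht h4
  have h6 := Nat.le_mul_of_pos_left (Θ ^ (Θ * t)) hpos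
  omega

theorem exists_dominating_family
    (hR : ∀ p, ∃ A : Finset V, 2 * D ≤ #A ∧ ∀ v ∈ A, ∃ q, cen q = v ∧ R p q) (hD : 0 < D)
    (hC : ∀ v w, v ∈ C w → w ∈ C v) (hβ : ∀ v, #(C v) ≤ β) (hΘ : Fintype.card X ≤ Θ * D)
    (hΘ2 : 2 ≤ Θ) {t : ℕ} (ht : Fintype.card X < 2 ^ t) (k : ℕ) (hk : k * (Θ * t * β) ≤ D) :
    ∃ S : ℕ → Finset X, (∀ i < k, #(S i) ≤ Θ * t) ∧ (∀ i < k, ∀ p, ∃ q ∈ S i, R p q) ∧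
      ∀ i < k, ∀ i' < k, ∀ q ∈ S i, ∀ q' ∈ S i', cen q ∈ C (cen q') → i = i' ∧ q = q' := by
  induction k with
  | zero => exact ⟨fun _ => ∅, by simp, by simp, by simp⟩
  | succ k ih =>
    rw [Nat.add_mul] at hk
    obtain ⟨S, hS, hSR, hSC⟩ := ih (by omega)
    set B := (range k).biUnion fun i => (S i).biUnion fun q => C (cen q) with hBdef
    have hB : #B ≤ k * (Θ * t * β) := by
      have := card_biUnion_le_card_mul (range k) (fun i => (S i).biUnion fun q => C (cen q))
        (Θ * t * β) fun i hi => (card_biUnion_le_card_mul _ _ _ fun q _ => hβ _).trans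
          (Nat.mul_le_mul_right _ (hS i (mem_range.1 hi)))
      simpa using this
    obtain ⟨T, hT, hTB, hTC, hTR⟩ :=
      exists_dominating hR hD hC hβ hΘ hΘ2 ht B (by omega)
    have hold : ∀ i < k, Function.update S k T i = S i := fun i hi =>
      Function.update_of_ne hi.ne _ _
    have hnew : Function.update S k T k = T := Function.update_self _ _ _
    have hTS : ∀ i < k, ∀ q ∈ S i, ∀ q' ∈ T, cen q' ∉ C (cen q) := fun i hi q hq q' hq' h =>
      hTB q' hq' (mem_biUnion.2 ⟨i, mem_range.2 hi, mem_biUnion.2 ⟨q, hq, h⟩⟩)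
    refine ⟨Function.update S k T, fun i hi => ?_, fun i hi => ?_, fun i hi i' hi' => ?_⟩
    · rcases Nat.lt_succ_iff_lt_or_eq.1 hi with h | rfl
      · rw [hold i h]; exact hS i h
      · rwa [hnew]
    · rcases Nat.lt_succ_iff_lt_or_eq.1 hi with h | rfl
      · rw [hold i h]; exact hSR i h
      · rwa [hnew]
    · rcases Nat.lt_succ_iff_lt_or_eq.1 hi with h | rfl <;>
        rcases Nat.lt_succ_iff_lt_or_eq.1 hi' with h' | rfl
      · rw [hold i h, hold i' h']; exact hSC i h i' h'
      · rw [hold i h, hnew]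
        exact fun q hq q' hq' hqq => absurd (hC _ _ hqq) (hTS i h q hq q' hq')
      · rw [hold i' h', hnew]
        exact fun q hq q' hq' hqq => absurd hqq (hTS i' h' q' hq' q hq)
      · rw [hnew]
        exact fun q hq q' hq' hqq => ⟨rfl, hTC q hq q' hq' hqq⟩

end Domination

section Pairs

open Finset

variable {V : Type*} [Fintype V] [DecidableEq V]

theorem exists_ne_large_inter {N : V → Finset V} {t : ℕ} (ht : 0 < t)
    (hN : ∀ v, Fintype.card V ≤ t * #(N v)) (hV : 0 < Fintype.card V) {T : Finset V}
    (hT : 2 * t ≤ #T) :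
    ∃ x ∈ T, ∃ y ∈ T, x ≠ y ∧ Fintype.card V ≤ 4 * t ^ 2 * #(N x ∩ N y) := by
  obtain ⟨T', hT'T, hT'⟩ := exists_subset_card_eq hT
  suffices h : ∃ x ∈ T', ∃ y ∈ T', x ≠ y ∧ Fintype.card V ≤ 4 * t ^ 2 * #(N x ∩ N y) by
    obtain ⟨x, hx, y, hy, h⟩ := h
    exact ⟨x, hT'T hx, y, hT'T hy, h⟩
  by_contra! hcon
  set n := Fintype.card V
  let d : V → ℕ := fun w => #{x ∈ T' | w ∈ N x}
  have hsum1 : ∑ w, d w = ∑ x ∈ T', #(N x) := by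
    simp_rw [d, card_filter]
    rw [sum_comm]
    refine sum_congr rfl fun x _ => ?_
    simp
  have hsum2 : ∑ w, d w * d w = ∑ x ∈ T', ∑ y ∈ T', #(N x ∩ N y) := by
    have : ∀ w, d w * d w = ∑ x ∈ T', ∑ y ∈ T', if w ∈ N x ∩ N y then 1 else 0 := by
      intro w
      simp_rw [d, card_filter, sum_mul_sum, mem_inter, ite_and]
      refine sum_congr rfl fun x _ => sum_congr rfl fun y _ => ?_
      split_ifs <;> rfl
    simp_rw [this]
    rw [sum_comm]
    refine sum_congr rfl fun x _ => ?_
    rw [sum_comm]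
    refine sum_congr rfl fun y _ => ?_
    rw [sum_boole, filter_mem_eq_inter, univ_inter, Nat.cast_id]
  have hlow : 2 * n ≤ ∑ w, d w := by
    refine Nat.le_of_mul_le_mul_left ?_ ht
    rw [hsum1, mul_sum]
    calc t * (2 * n) = ∑ x ∈ T', n := by simp [hT']; ring
      _ ≤ _ := sum_le_sum fun x _ => hN x
  have hconv : 3 * ∑ w, d w ≤ ∑ w, d w * d w + 2 * n := by
    have : ∑ w, 3 * d w ≤ ∑ w, (d w * d w + 2) := sum_le_sum fun w _ => by
      rcases Nat.lt_or_ge (d w) 2 with h | h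
      · interval_cases d w <;> norm_num
      · obtain ⟨e, he⟩ := Nat.exists_eq_add_of_le h
        rw [he]
        nlinarith [Nat.zero_le (e * e)]
    rw [← mul_sum, sum_add_distrib] at this
    simpa [n, mul_comm] using this
  have hoff : ∑ x ∈ T', ∑ y ∈ T', #(N x ∩ N y)
      ≤ ∑ x ∈ T', #(N x) + ∑ x ∈ T', ∑ y ∈ T'.erase x, #(N x ∩ N y) := by
    rw [← sum_add_distrib]
    refine sum_le_sum fun x hx => ?_
    rw [← add_sum_erase _ _ hx, inter_self]
  have hup : 4 * t ^ 2 * ∑ x ∈ T', ∑ y ∈ T'.erase x, #(N x ∩ N y) ≤ 4 * t ^ 2 * n := by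
    calc _ = ∑ x ∈ T', ∑ y ∈ T'.erase x, 4 * t ^ 2 * #(N x ∩ N y) := by simp_rw [mul_sum]
      _ ≤ ∑ x ∈ T', ∑ y ∈ T'.erase x, n := sum_le_sum fun x hx => sum_le_sum fun y hy =>
          (hcon x hx y (mem_of_mem_erase hy) (ne_of_mem_erase hy).symm).le
      _ ≤ ∑ x ∈ T', ∑ y ∈ T', n := sum_le_sum fun x _ =>
          sum_le_sum_of_subset (erase_subset _ _)
      _ = _ := by simp [hT']; ring
  have hup' := Nat.le_of_mul_le_mul_left hup (by positivity)
  omega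

open Classical in
theorem card_le_mul_card_close_pairs {N : V → Finset V} {t m : ℕ} (ht : 0 < t)
    (hm : m = 32 * t ^ 3) (hN : ∀ v, Fintype.card V ≤ t * #(N v)) (hV : 0 < Fintype.card V)
    (h : Equiv.Perm V) {W : Finset V} (hW : Fintype.card V ≤ 8 * t ^ 2 * #W)
    (hlong : ∀ w ∈ W, ∀ a, 0 < a → a < m → (h ^ a) w ≠ w) :
    Fintype.card V ≤ 512 * t ^ 5 * #{x ∈ W | ∃ a, 0 < a ∧ a < m ∧ (h ^ a) x ∈ W ∧
      Fintype.card V ≤ 4 * t ^ 2 * #(N x ∩ N ((h ^ a) x))} := by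
  set n := Fintype.card V with hn
  set K : Finset V := {x ∈ W | ∃ a, 0 < a ∧ a < m ∧ (h ^ a) x ∈ W ∧
      n ≤ 4 * t ^ 2 * #(N x ∩ N ((h ^ a) x))} with hK
  let J : V → Finset ℕ := fun z => {a ∈ range m | (h ^ a) z ∈ W}
  have hsum : ∑ z, #(J z) = m * #W := by
    simp_rw [J, card_filter]
    rw [sum_comm]
    calc _ = ∑ a ∈ range m, #W := sum_congr rfl fun a _ => by
          rw [Equiv.sum_comp (h ^ a) fun z => if z ∈ W then 1 else 0]
          simp
      _ = _ := by simp
  set Rich : Finset V := {z | 2 * t ≤ #(J z)} with hRich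
  have hrich : n ≤ 16 * t ^ 2 * #Rich := by
    have h1 : ∑ z, #(J z) ≤ #Rich * m + n * (2 * t) := by
      calc ∑ z, #(J z) ≤ ∑ z, ((if 2 * t ≤ #(J z) then m else 0) + 2 * t) := by
            refine sum_le_sum fun z _ => ?_
            have : #(J z) ≤ m := (card_filter_le _ _).trans (by simp)
            split_ifs <;> omega
        _ = _ := by
            rw [sum_add_distrib, ← sum_filter]
            simp [hRich, n]
    have h2 := Nat.mul_le_mul_left m hW
    have h3 := Nat.mul_le_mul_left (8 * t ^ 2) (hsum ▸ h1)
    have h4 : 16 * t ^ 3 * n ≤ 16 * t ^ 3 * (16 * t ^ 2 * #Rich) := by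
      rw [hm] at h2 h3
      nlinarith
    exact Nat.le_of_mul_le_mul_left h4 (by positivity)
  have hcov : Rich ⊆ K.biUnion fun x => (range m).image fun a => (h ^ a).symm x := by
    intro z hz
    have hz' : 2 * t ≤ #(J z) := by simpa [hRich] using hz
    have hne : ∀ a ∈ J z, ∀ b ∈ J z, a < b → (h ^ a) z ≠ (h ^ b) z := by
      intro a ha b hb hab he
      simp only [J, mem_filter, mem_range] at ha hb
      refine hlong _ ha.2 (b - a) (by omega) (by omega) ?_
      rw [← Equiv.Perm.mul_apply, ← pow_add, Nat.sub_add_cancel hab.le, he]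
    have hinj : Set.InjOn (fun a => (h ^ a) z) (J z) := by
      intro a ha b hb he
      rcases lt_trichotomy a b with hab | hab | hab
      · exact absurd he (hne a ha b hb hab)
      · exact hab
      · exact absurd he.symm (hne b hb a ha hab)
    obtain ⟨x, hx, y, hy, hxy, hN2⟩ := exists_ne_large_inter ht hN hV
      (T := (J z).image fun a => (h ^ a) z) (by rwa [card_image_of_injOn hinj])
    obtain ⟨a, ha, rfl⟩ := mem_image.1 hx
    obtain ⟨b, hb, rfl⟩ := mem_image.1 hy
    have main : ∀ a ∈ J z, ∀ b ∈ J z, a < b →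
        n ≤ 4 * t ^ 2 * #(N ((h ^ a) z) ∩ N ((h ^ b) z)) →
        z ∈ K.biUnion fun x => (range m).image fun a => (h ^ a).symm x := by
      intro a ha b hb hab hg
      simp only [J, mem_filter, mem_range] at ha hb
      have he : (h ^ (b - a)) ((h ^ a) z) = (h ^ b) z := by
        rw [← Equiv.Perm.mul_apply, ← pow_add, Nat.sub_add_cancel hab.le]
      refine mem_biUnion.2 ⟨(h ^ a) z, ?_, mem_image.2 ⟨a, by simpa using ha.1, by simp⟩⟩
      rw [hK, mem_filter]
      exact ⟨ha.2, b - a, by omega, by omega, by rw [he]; exact hb.2, by rwa [he]⟩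
    rcases lt_trichotomy a b with hab | hab | hab
    · exact main a ha b hb hab hN2
    · exact absurd (by rw [hab]) hxy
    · exact main b hb a ha hab (by rwa [inter_comm])
  have hRK : #Rich ≤ #K * m := (card_le_card hcov).trans <|
    card_biUnion_le_card_mul _ _ _ fun x _ => card_image_le.trans (by simp)
  calc n ≤ 16 * t ^ 2 * #Rich := hrich
    _ ≤ 16 * t ^ 2 * (#K * m) := Nat.mul_le_mul_left _ hRK
    _ = _ := by rw [hm]; ring

open Classical in
theorem card_short_cycles_le (f : Equiv.Perm V) (M : ℕ) :
    #{v | ∃ j, 0 < j ∧ j ≤ M ∧ (f ^ j) v = v} ≤ f.cycleCount * M := by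
  set Z : Finset V := {v | ∃ j, 0 < j ∧ j ≤ M ∧ (f ^ j) v = v} with hZ
  let s := Equiv.Perm.SameCycle.setoid f
  have : Fintype (Quotient s) := Fintype.ofFinite _
  let F : Quotient s → Finset V := fun q =>
    if h : ∃ v ∈ Z, Quotient.mk s v = q then (range M).image fun j => (f ^ j) h.choose else ∅
  have hcov : Z ⊆ univ.biUnion F := by
    intro v hv
    have hex : ∃ w ∈ Z, Quotient.mk s w = Quotient.mk s v := ⟨v, hv, rfl⟩
    refine mem_biUnion.2 ⟨Quotient.mk s v, mem_univ _, ?_⟩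
    simp only [F, dif_pos hex]
    obtain ⟨hw, hwv⟩ := hex.choose_spec
    set w := hex.choose
    obtain ⟨p, hp, hpM, hpw⟩ : ∃ j, 0 < j ∧ j ≤ M ∧ (f ^ j) w = w := by simpa [hZ] using hw
    obtain ⟨j, hj⟩ := (Quotient.exact hwv : f.SameCycle w v).exists_nat_pow_eq
    refine mem_image.2 ⟨j % p, mem_range.2 ((Nat.mod_lt _ hp).trans_le hpM), ?_⟩
    have hper : ∀ e : ℕ, (f ^ (p * e)) w = w := by
      intro e
      rw [pow_mul]
      induction e with
      | zero => rfl
      | succ e ih => rw [pow_succ, Equiv.Perm.mul_apply, hpw, ih]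
    rw [← hj]
    conv_rhs => rw [← Nat.mod_add_div j p, pow_add, Equiv.Perm.mul_apply, hper]
  have hF : ∀ q, #(F q) ≤ M := by
    intro q
    simp only [F]
    split_ifs
    · exact card_image_le.trans (by simp)
    · simp
  have := (card_le_card hcov).trans (card_biUnion_le_card_mul _ _ M fun q _ => hF q)
  rwa [card_univ, ← Nat.card_eq_fintype_card] at this

end Pairs

section Reroute

open Finset

/-- The permutation of all pairs `(i, x)` with `x` a periodic point of `F i`, induced by `F`. -/
noncomputable def periodicPerm {κ X : Type*} (F : κ → X → X) :
    Equiv.Perm {p : κ × X // p.2 ∈ Function.periodicPts (F p.1)} :=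
  Equiv.ofBijective
    (fun p => ⟨(p.1.1, F p.1.1 p.1.2), (Function.bijOn_periodicPts (F p.1.1)).mapsTo p.2⟩) <| by
    constructor
    · rintro ⟨⟨i, x⟩, hx⟩ ⟨⟨i', x'⟩, hx'⟩ h
      simp only [Subtype.mk.injEq, Prod.mk.injEq] at h
      obtain ⟨rfl, h⟩ := h
      simpa using (Function.bijOn_periodicPts (F i)).injOn hx hx' h
    · rintro ⟨⟨i, x⟩, hx⟩
      obtain ⟨y, hy, rfl⟩ := (Function.bijOn_periodicPts (F i)).surjOn hx
      exact ⟨⟨(i, y), hy⟩, rfl⟩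

theorem nonempty_periodicPts {X : Type*} [Finite X] [Nonempty X] (F : X → X) :
    (Function.periodicPts F).Nonempty := by
  obtain ⟨x⟩ := ‹Nonempty X›
  obtain ⟨a, b, hab, he⟩ := Finite.exists_ne_map_eq_of_infinite fun j : ℕ => F^[j] x
  wlog h : a < b generalizing a b
  · exact this b a hab.symm he.symm (by omega)
  refine ⟨F^[a] x, Function.mk_mem_periodicPts (n := b - a) (by omega) ?_⟩
  rw [Function.IsPeriodicPt, Function.IsFixedPt, ← Function.iterate_add_apply,
    Nat.sub_add_cancel h.le]
  exact he.symm

theorem pow_natAbs_apply_eq_self {V : Type*} (f : Equiv.Perm V) {j : ℤ} {v : V}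
    (h : (f ^ j) v = v) :
    (f ^ j.natAbs) v = v := by
  rcases Int.natAbs_eq j with hj | hj
  · rwa [← zpow_natCast, ← hj]
  · rw [hj, zpow_neg, Equiv.Perm.inv_eq_iff_eq, zpow_natCast] at h
    exact h.symm

theorem exists_perm_cycleCount_eq {V : Type*} [Fintype V] {G : SimpleGraph V}
    [DecidableRel G.Adj] {f : Equiv.Perm V} {t k : ℕ} (hf : ∀ v, G.Adj v (f v))
    (hff : ∀ v, f (f v) ≠ v) (ht : 0 < t) (hk : 0 < k)
    (hdeg : ∀ v, Fintype.card V ≤ t * #{w | G.Adj v (f w)})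
    (hcard : 2 ^ 36 * t ^ 17 * k ≤ Fintype.card V) (hlog : 32 * t ^ 3 * Fintype.card V < 2 ^ t)
    (hfk : f.cycleCount ≤ k) :
    ∃ g : Equiv.Perm V, (∀ v, G.Adj v (g v)) ∧ (∀ v, g (g v) ≠ v) ∧ g.cycleCount = k := by
  classical
  set n := Fintype.card V with hn
  set N : V → Finset V := fun v => {w | G.Adj v (f w)}
  obtain ⟨m, hm⟩ : ∃ m, m = 32 * t ^ 3 := ⟨_, rfl⟩
  have ht3 : 0 < t ^ 3 := by positivity
  have hn0 : 0 < n := lt_of_lt_of_le (by positivity) hcard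
  have ht5 : 0 < t ^ 5 := by positivity
  have hpow : t ^ 5 * k ≤ t ^ 17 * k :=
    Nat.mul_le_mul_right _ (Nat.pow_le_pow_right ht (by norm_num))
  have hpow' : t ^ 5 ≤ t ^ 5 * k := Nat.le_mul_of_pos_right _ hk
  set Z : Finset V := {v | ∃ j, 0 < j ∧ j ≤ 6 * m ∧ (f ^ j) v = v}
  have hZ : #Z ≤ k * (6 * m) :=
    (card_short_cycles_le f _).trans (Nat.mul_le_mul_right _ hfk)
  let Good : V × Fin m → Prop := fun p => p.1 ∉ Z ∧ 0 < (p.2 : ℕ) ∧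
    n ≤ 4 * t ^ 2 * #(N p.1 ∩ N ((f ^ (3 * (p.2 : ℕ))) p.1))
  let X := {p : V × Fin m // Good p}
  let cen : X → V := fun p => p.1.1
  let len : X → ℕ := fun p => 3 * (p.1.2 : ℕ)
  let R : X → X → Prop := fun p q =>
    ∀ s s', G.Adj (pairPoint f cen len (p, s)) (f (pairPoint f cen len (q, s')))
  set D := n / (1024 * t ^ 5) with hD
  have hDn : D * (1024 * t ^ 5) ≤ n := Nat.div_mul_le_self _ _
  have hclose : ∀ U : Finset V, n ≤ 4 * t ^ 2 * #U → ∃ A : Finset V, 2 * D ≤ #A ∧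
      ∀ v ∈ A, ∃ q : X, cen q = v ∧ ∀ s, pairPoint f cen len (q, s) ∈ U := by
    intro U hU
    have hW : n ≤ 8 * t ^ 2 * #(U \ Z) := by
      have h1 := Nat.mul_le_mul_left (8 * t ^ 2) (le_card_sdiff Z U)
      have h2 := Nat.mul_le_mul_left (8 * t ^ 2) hZ
      rw [Nat.mul_sub] at h1
      have h3 : 8 * t ^ 2 * (k * (6 * m)) = 1536 * (t ^ 5 * k) := by rw [hm]; ring
      have h4 : 8 * t ^ 2 * #U = 2 * (4 * t ^ 2 * #U) := by ring
      rw [mul_assoc] at hcard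
      omega
    have h := card_le_mul_card_close_pairs ht hm hdeg hn0 (f ^ 3) hW <| by
      intro w hw a ha ham he
      refine (mem_sdiff.1 hw).2 (mem_filter.2 ⟨mem_univ _, 3 * a, by omega, by omega, ?_⟩)
      rwa [pow_mul]
    have hDn' : 512 * t ^ 5 * (2 * D) ≤ n := by linarith
    refine ⟨_, Nat.le_of_mul_le_mul_left (hDn'.trans h) (by positivity), fun v hv => ?_⟩
    obtain ⟨hvW, a, ha, ham, haW, hcod⟩ := mem_filter.1 hv
    rw [← pow_mul] at haW hcod
    refine ⟨⟨(v, ⟨a, ham⟩), (mem_sdiff.1 hvW).2, ha, hcod⟩, rfl, ?_⟩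
    rintro (_ | _)
    · exact (mem_sdiff.1 hvW).1
    · exact (mem_sdiff.1 haW).1
  have hR : ∀ p, ∃ A : Finset V, 2 * D ≤ #A ∧ ∀ v ∈ A, ∃ q, cen q = v ∧ R p q := by
    intro p
    obtain ⟨A, hA, h⟩ := hclose _ p.2.2.2
    refine ⟨A, hA, fun v hv => ?_⟩
    obtain ⟨q, hq, hqU⟩ := h v hv
    refine ⟨q, hq, fun s s' => ?_⟩
    have h1 := mem_inter.1 (hqU s')
    cases s
    · exact (mem_filter.1 h1.1).2
    · exact (mem_filter.1 h1.2).2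
  have hDpos : 0 < D := Nat.div_pos (by linarith) (by positivity)
  have hXne : Nonempty X := by
    obtain ⟨A, hA, h⟩ := hclose univ <| by
      rw [card_univ]
      exact Nat.le_mul_of_pos_left _ (by positivity)
    obtain ⟨v, hv⟩ := card_pos.1 (show 0 < #A by omega)
    obtain ⟨q, -⟩ := h v hv
    exact ⟨q⟩
  let C : V → Finset V := fun v => (Icc (-(6 * m : ℤ)) (6 * m)).image fun j => (f ^ j) v
  have hC : ∀ v w, v ∈ C w → w ∈ C v := by
    intro v w h
    obtain ⟨j, hj, rfl⟩ := mem_image.1 h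
    rw [mem_Icc] at hj
    exact mem_image.2 ⟨-j, mem_Icc.2 ⟨by omega, by omega⟩, by simp⟩
  have hβ : ∀ v, #(C v) ≤ 13 * m := by
    intro v
    refine card_image_le.trans ?_
    rw [Int.card_Icc]
    omega
  have hXcard : Fintype.card X ≤ 32 * t ^ 3 * n := by
    refine (Fintype.card_subtype_le _).trans ?_
    rw [Fintype.card_prod, Fintype.card_fin, hm, mul_comm]
  have hΘ : Fintype.card X ≤ 2 ^ 16 * t ^ 8 * D := by
    have h1 : n < (D + 1) * (1024 * t ^ 5) := by
      rw [mul_comm]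
      exact Nat.lt_mul_div_succ _ (by positivity)
    have h2 : n ≤ 2048 * t ^ 5 * D := by nlinarith
    calc _ ≤ 32 * t ^ 3 * n := hXcard
      _ ≤ 32 * t ^ 3 * (2048 * t ^ 5 * D) := Nat.mul_le_mul_left _ h2
      _ = _ := by ring
  have hkD : k * (2 ^ 16 * t ^ 8 * t * (13 * m)) ≤ D := by
    rw [hD, Nat.le_div_iff_mul_le (by positivity)]
    calc _ = 416 * 2 ^ 26 * (t ^ 17 * k) := by rw [hm]; ring
      _ ≤ 2 ^ 36 * t ^ 17 * k := by rw [mul_assoc (2 ^ 36)]; gcongr; norm_num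
      _ ≤ n := hcard
  obtain ⟨S, -, hSR, hSC⟩ := exists_dominating_family hR hDpos hC hβ hΘ
    (by have : 0 < t ^ 8 := by positivity
        omega) (hXcard.trans_lt hlog) k hkD
  choose F hF hFR using fun (i : Fin k) (p : X) => hSR i i.2 p
  have hperS : ∀ i q, q ∈ Function.periodicPts (F i) → q ∈ S i := by
    intro i q hq
    obtain ⟨q, -, rfl⟩ := (Function.bijOn_periodicPts (F i)).surjOn hq
    exact hF i q
  let P : PairSystem G f {p : Fin k × X // p.2 ∈ Function.periodicPts (F p.1)} :=
    { base := fun p => cen p.1.2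
      len := fun p => len p.1.2
      next := periodicPerm F
      bound := 3 * m
      three_le_len := fun p => by
        have := p.1.2.2.2.1
        simp only [len]
        omega
      len_le := fun p => by
        have := p.1.2.1.2.2
        simp only [len]
        omega
      separated := by
        rintro ⟨⟨i, q⟩, hq⟩ ⟨⟨i', q'⟩, hq'⟩ j hj he
        have hj' := abs_le.1 hj
        push_cast at hj'
        have hmem : cen q' ∈ C (cen q) :=
          mem_image.2 ⟨j, mem_Icc.2 ⟨by omega, by omega⟩, he⟩
        obtain ⟨h1, rfl⟩ := hSC i' i'.2 i i.2 q' (hperS _ _ hq') q (hperS _ _ hq) hmem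
        obtain rfl := Fin.ext h1
        refine ⟨rfl, ?_⟩
        by_contra hj0
        exact q'.2.1 (mem_filter.2 ⟨mem_univ _, j.natAbs, by omega, by omega,
          pow_natAbs_apply_eq_self f he⟩)
      adj := fun p s s' => hFR p.1.1 p.1.2 s s' }
  obtain ⟨b, hb⟩ := P.exists_reroute_cycleCount_eq (fun p => p.1.1)
    (fun i => by
      obtain ⟨q, hq⟩ := nonempty_periodicPts (F i)
      exact ⟨⟨(i, q), hq⟩, rfl⟩)
    (fun _ => rfl) hfk
  exact ⟨_, P.adj_reroute hf b, P.reroute_reroute_ne hff b, hb⟩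

end Reroute

theorem card_filter_adj_apply {V : Type*} [Fintype V] (G : SimpleGraph V) [DecidableRel G.Adj]
    (f : Equiv.Perm V) (v : V) :
    ({w | G.Adj v (f w)} : Finset V).card = (G.neighborSet v).ncard := by
  rw [← Set.ncard_coe_finset, ← Set.ncard_image_of_injective _ f.injective]
  congr 1
  ext w
  simp only [Finset.coe_filter, Finset.mem_univ, true_and, Set.mem_image, Set.mem_ofPred_eq,
    SimpleGraph.mem_neighborSet]
  exact ⟨by rintro ⟨w, hw, rfl⟩; exact hw, fun hw => ⟨f.symm w, by simpa using hw, by simp⟩⟩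

theorem exists_isTwoFactor_numCycles_eq {V : Type*} [Fintype V] {G : SimpleGraph V} {t k : ℕ}
    (ht : 0 < t) (hk : 0 < k) (hdeg : ∀ v, Fintype.card V ≤ t * (G.neighborSet v).ncard)
    (hcard : 2 ^ 36 * t ^ 17 * k ≤ Fintype.card V) (hlog : 32 * t ^ 3 * Fintype.card V < 2 ^ t)
    (hH : ∃ H, IsTwoFactor G H ∧ numCycles H ≤ k) : ∃ H, IsTwoFactor G H ∧ numCycles H = k := by
  classical
  obtain ⟨H, hHG, hHk⟩ := hH
  obtain ⟨f, hf⟩ := exists_isOrientation H hHG.2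
  rw [hf.numCycles_eq] at hHk
  obtain ⟨g, hg, hgg, hgk⟩ := exists_perm_cycleCount_eq (G := G) (f := f)
    (fun v => hHG.1 ((hf.1 _ _).2 (.inl rfl))) hf.2 ht hk
    (fun v => by rw [card_filter_adj_apply G f v]; exact hdeg v) hcard hlog hHk
  obtain ⟨H', hH'⟩ := exists_isOrientation_of_perm g hgg
  refine ⟨H', ⟨fun v w h => ?_, hH'.ncard_neighborSet⟩, hH'.numCycles_eq.trans hgk⟩
  rcases (hH'.1 _ _).1 h with rfl | rfl
  · exact hg v
  · exact (hg w).symm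

open Filter in
theorem eventually_mul_pow_four_lt_two_rpow {ε : ℝ} (hε : 0 < ε) (C : ℝ) :
    ∀ᶠ n : ℕ in atTop, C * (n : ℝ) ^ 4 < 2 ^ ((n : ℝ) ^ ε) := by
  have h1 := tendsto_rpow_mul_exp_neg_mul_atTop_nhds_zero (4 / ε) (Real.log 2)
    (Real.log_pos one_lt_two)
  have h2 := (h1.comp ((tendsto_rpow_atTop hε).comp tendsto_natCast_atTop_atTop)).const_mul C
  rw [mul_zero] at h2
  filter_upwards [h2.eventually_lt_const one_pos] with n hn
  simp only [Function.comp_apply] at hn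
  rw [← Real.rpow_mul (Nat.cast_nonneg n), mul_div_cancel₀ _ hε.ne', neg_mul, Real.exp_neg,
    ← Real.rpow_def_of_pos two_pos, ← mul_assoc, ← div_eq_mul_inv, div_lt_one (by positivity)] at hn
  exact_mod_cast hn

theorem stmt0 :
    ∀ δ : ℝ, 0 < δ → δ ≤ 1 →
      ∃ ε : ℝ, 0 < ε ∧ ∃ n₀ : ℕ, ∀ n : ℕ, n₀ ≤ n →
        ∀ G : SimpleGraph (Fin n),
          (∀ v : Fin n, (n : ℝ) ^ (1 - ε) ≤ ((G.neighborSet v).ncard : ℝ)) →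
          ∀ k : ℕ, 1 ≤ k → (k : ℝ) ≤ (n : ℝ) ^ (1 - δ) →
            (∃ H : SimpleGraph (Fin n), IsTwoFactor G H ∧ numCycles H ≤ k) →
            ∃ H : SimpleGraph (Fin n), IsTwoFactor G H ∧ numCycles H = k := by
  intro δ hδ hδ1
  have hε : 0 < δ / 34 := by positivity
  refine ⟨δ / 34, hε, ?_⟩
  obtain ⟨n₀, hn₀⟩ := Filter.eventually_atTop.1 <|
    (Filter.eventually_ge_atTop 1).and <| (eventually_mul_pow_four_lt_two_rpow hε 256).and <|
      ((tendsto_rpow_atTop (half_pos hδ)).comp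
        tendsto_natCast_atTop_atTop).eventually_ge_atTop (2 ^ 53)
  refine ⟨n₀, fun n hn G hG k hk hkn hH => ?_⟩
  obtain ⟨hn1, hlog, hpow⟩ := hn₀ n hn
  have hn1' : (1 : ℝ) ≤ n := by exact_mod_cast hn1
  have hn0 : (0 : ℝ) < n := by linarith
  set y : ℝ := (n : ℝ) ^ (δ / 34) with hy
  have hy1 : 1 ≤ y := Real.one_le_rpow hn1' hε.le
  set t := ⌈y⌉₊ with ht
  have hyt : y ≤ t := Nat.le_ceil y
  have hty : (t : ℝ) ≤ 2 * y := by
    have := Nat.ceil_lt_add_one (show 0 ≤ y by linarith)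
    linarith
  refine exists_isTwoFactor_numCycles_eq (t := t) (Nat.ceil_pos.2 (by linarith)) hk
    (fun v => ?_) ?_ ?_ hH
  · rw [Fintype.card_fin]
    have h : (n : ℝ) = y * (n : ℝ) ^ (1 - δ / 34) := by
      rw [hy, ← Real.rpow_add hn0, add_sub_cancel, Real.rpow_one]
    have : (n : ℝ) ≤ t * (G.neighborSet v).ncard := by
      conv_lhs => rw [h]
      exact mul_le_mul hyt (hG v) (by positivity) (by positivity)
    exact_mod_cast this
  · rw [Fintype.card_fin]
    have h17 : y ^ 17 = (n : ℝ) ^ (δ / 2) := by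
      rw [hy, ← Real.rpow_natCast, ← Real.rpow_mul hn0.le]
      congr 1
      push_cast
      ring
    have hsplit : (n : ℝ) ^ (δ / 2) * ((n : ℝ) ^ (δ / 2) * (n : ℝ) ^ (1 - δ)) = n := by
      rw [← Real.rpow_add hn0, ← Real.rpow_add hn0]
      convert Real.rpow_one (n : ℝ) using 2
      ring
    have : (2 : ℝ) ^ 36 * t ^ 17 * k ≤ n :=
      calc (2 : ℝ) ^ 36 * t ^ 17 * k ≤ 2 ^ 36 * (2 * y) ^ 17 * (n : ℝ) ^ (1 - δ) := by gcongr
        _ = 2 ^ 53 * ((n : ℝ) ^ (δ / 2) * (n : ℝ) ^ (1 - δ)) := by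
          rw [mul_pow, h17]
          ring
        _ ≤ (n : ℝ) ^ (δ / 2) * ((n : ℝ) ^ (δ / 2) * (n : ℝ) ^ (1 - δ)) :=
          mul_le_mul_of_nonneg_right hpow (by positivity)
        _ = n := hsplit
    exact_mod_cast this
  · rw [Fintype.card_fin]
    have hyn : y ≤ n := by
      simpa using Real.rpow_le_rpow_of_exponent_le hn1' (show δ / 34 ≤ 1 by linarith)
    have : (32 : ℝ) * t ^ 3 * n < 2 ^ t :=
      calc (32 : ℝ) * t ^ 3 * n ≤ 32 * (2 * n) ^ 3 * n := by
            gcongr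
            linarith
        _ = 256 * (n : ℝ) ^ 4 := by ring
        _ < 2 ^ y := hlog
        _ ≤ 2 ^ (t : ℝ) := Real.rpow_le_rpow_of_exponent_le one_le_two hyt
        _ = 2 ^ t := Real.rpow_natCast 2 t
    exact_mod_cast this
end

section
/- There exists n₀ ∈ ℕ such that the following holds for all n ≥ n₀. Let G be an n-vertex graph and let 𝒞 be a Hamilton cycle on the vertex set V(G) (not necessarily a subgraph of G). Let E ⊆ E(𝒞) and B ⊆ V(G) be such that B' := B ∪ V(E) ≠ V(G), where V(E) denotes the set of endpoints of edges in E. Suppose that every vertex v ∈ V(G)∖B' satisfies d_G(v) ≥ √n·(log n)² + 3|B'| + 2. Then the graph G ∪ 𝒞 contains a Hamilton cycle 𝒞' different from 𝒞 such that E ⊆ E(𝒞'). -/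
/-- `C` is a Hamilton cycle on its (whole) vertex set: a connected 2-regular graph. -/
def IsHamCycleOn {V : Type*} (C : SimpleGraph V) : Prop :=
  C.Connected ∧ ∀ v : V, (C.neighborSet v).ncard = 2

/-- The involution of `Fin N` fixing `0, …, i` and reversing `i + 1, …, N - 1`. -/
def reverseAfter {N : ℕ} (i : Fin N) : Equiv.Perm (Fin N) :=
  Function.Involutive.toPerm
    (fun j => if h : j.val ≤ i.val then j else ⟨N + i.val - j.val, by omega⟩) (by
      intro j
      have := j.isLt
      ext
      dsimp only
      split_ifs with h₁ h₂ <;> simp_all <;> omega)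

lemma reverseAfter_val {N : ℕ} (i j : Fin N) :
    (reverseAfter i j).val = if j.val ≤ i.val then j.val else N + i.val - j.val := by
  change (if h : j.val ≤ i.val then j else ⟨N + i.val - j.val, by omega⟩ : Fin N).val = _
  split_ifs <;> rfl

lemma reverseAfter_reverseAfter {N : ℕ} (i j : Fin N) :
    reverseAfter i (reverseAfter i j) = j := by
  have := j.isLt
  ext
  simp only [reverseAfter_val]
  split_ifs <;> omega

/-- `P` enumerates a Hamilton path of `H` that starts with `x`, `y`, ends in a neighbour of `A` and
uses every edge of `H` that does not meet `A`. -/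
structure IsThreadedPath {V : Type*} {m : ℕ} (H : SimpleGraph V) (A : Set V) (x y : V)
    (P : Fin (m + 3) ≃ V) : Prop where
  zero : P 0 = x
  one : P 1 = y
  last : ∃ a ∈ A, H.Adj a (P (Fin.last _))
  adj : ∀ i j : Fin (m + 3), i.val + 1 = j.val → H.Adj (P i) (P j)
  edge : ∀ i j : Fin (m + 3), H.Adj (P i) (P j) → P i ∉ A → P j ∉ A →
    i.val + 1 = j.val ∨ j.val + 1 = i.val

section Parity

variable {V : Type*} {m : ℕ} {H : SimpleGraph V} {A : Set V} {x y : V}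

lemma IsThreadedPath.mem_of_adj_last {P : Fin (m + 3) ≃ V} (hP : IsThreadedPath H A x y P)
    (hA : ∀ a ∈ A, ∀ b ∈ A, ¬ H.Adj a b) {i : Fin (m + 3)} (hi : i.val < m + 1)
    (h : H.Adj (P (Fin.last _)) (P i)) : P i ∈ A := by
  by_contra hc
  obtain ⟨a, ha, hl⟩ := hP.last
  have := hP.edge _ _ h (fun h' => hA a ha _ h' hl) hc
  simp at this
  omega

/-- Rotating a threaded path along an edge from its last vertex to an inner vertex. -/
lemma IsThreadedPath.rotate {P : Fin (m + 3) ≃ V} (hP : IsThreadedPath H A x y P)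
    (hA : ∀ a ∈ A, ∀ b ∈ A, ¬ H.Adj a b) {i : Fin (m + 3)} (hi₀ : 0 < i.val)
    (hi : i.val < m + 1) (h : H.Adj (P (Fin.last _)) (P i)) :
    IsThreadedPath H A x y ((reverseAfter i).trans P) := by
  have hiA := hP.mem_of_adj_last hA hi h
  have key : ∀ j k : Fin (m + 3), j.val + 1 = k.val →
      ((reverseAfter i j).val + 1 = (reverseAfter i k).val ∨
        (reverseAfter i k).val + 1 = (reverseAfter i j).val) ∨
      (reverseAfter i j = i ∧ reverseAfter i k = Fin.last _) := by
    intro j k hjk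
    have := k.isLt
    simp only [Fin.ext_iff, reverseAfter_val, Fin.val_last]
    split_ifs <;> omega
  have key' : ∀ j k : Fin (m + 3), (reverseAfter i j).val + 1 = (reverseAfter i k).val →
      (j.val + 1 = k.val ∨ k.val + 1 = j.val) ∨ reverseAfter i j = i := by
    intro j k
    have := k.isLt
    have := j.isLt
    simp only [Fin.ext_iff, reverseAfter_val]
    split_ifs <;> omega
  refine ⟨?_, ?_, ⟨P i, hiA, ?_⟩, ?_, ?_⟩
  · have : reverseAfter i 0 = 0 := by ext; simp [reverseAfter_val]
    simp [this, hP.zero]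
  · have : reverseAfter i 1 = 1 := by
      ext
      exact (reverseAfter_val _ _).trans (if_pos hi₀)
    simp [this, hP.one]
  · apply hP.adj
    rw [reverseAfter_val, if_neg] <;> simp <;> omega
  · intro j k hjk
    simp only [Equiv.trans_apply]
    rcases key j k hjk with (h' | h') | ⟨h₁, h₂⟩
    · exact hP.adj _ _ h'
    · exact (hP.adj _ _ h').symm
    · rw [h₁, h₂]
      exact h.symm
  · intro j k hjk hj hk
    simp only [Equiv.trans_apply] at hjk hj hk
    rcases hP.edge _ _ hjk hj hk with h' | h'
    · rcases key' j k h' with h'' | h''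
      · exact h''
      · exact absurd (show P (reverseAfter i j) ∈ A by rwa [h'']) hj
    · rcases key' k j h' with h'' | h''
      · exact h''.symm
      · exact absurd (show P (reverseAfter i k) ∈ A by rwa [h'']) hk

open scoped Classical in
lemma IsThreadedPath.card_rotations [Fintype V] {P : Fin (m + 3) ≃ V}
    (hP : IsThreadedPath H A x y P)
    (hdeg : ∀ a ∈ A, ∀ u, H.Adj a u → (H.neighborSet u).ncard = 3) :
    (Finset.univ.filter fun i : Fin (m + 3) =>
        0 < i.val ∧ i.val < m + 1 ∧ H.Adj (P (Fin.last _)) (P i)).card +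
      (if H.Adj (P (Fin.last _)) x then 1 else 0) = 2 := by
  obtain ⟨a, ha, hl⟩ := hP.last
  have h3 := hdeg a ha _ hl
  have h3' : (Finset.univ.filter fun i : Fin (m + 3) => H.Adj (P (Fin.last _)) (P i)).card = 3 := by
    refine Eq.trans ?_ h3
    rw [← Set.ncard_coe_finset, ← Set.ncard_image_of_injective _ P.injective]
    congr 1
    ext v
    simp only [Finset.coe_filter, Finset.mem_univ, true_and, Set.mem_image, Set.mem_ofPred_eq,
      SimpleGraph.mem_neighborSet]
    exact ⟨fun ⟨i, hi, h⟩ => h ▸ hi, fun h => ⟨P.symm v, by simpa using h, by simp⟩⟩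
  have hpen : H.Adj (P (Fin.last _)) (P ⟨m + 1, by omega⟩) :=
    (hP.adj _ _ (by simp)).symm
  have hsplit : (Finset.univ.filter fun i : Fin (m + 3) => H.Adj (P (Fin.last _)) (P i)) =
      insert ⟨m + 1, by omega⟩ ((if H.Adj (P (Fin.last _)) x then {0} else ∅) ∪
        Finset.univ.filter fun i : Fin (m + 3) =>
        0 < i.val ∧ i.val < m + 1 ∧ H.Adj (P (Fin.last _)) (P i)) := by
    ext i
    have h0 : i.val = 0 → i = 0 := fun h => Fin.ext h
    have hl : i.val = m + 2 → i = Fin.last _ := fun h => Fin.ext h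
    have hp : i.val = m + 1 → i = ⟨m + 1, by omega⟩ := fun h => Fin.ext h
    have hz := hP.zero
    have := i.isLt
    have hirr := H.irrefl (v := P (Fin.last _))
    simp only [Finset.mem_filter, Finset.mem_univ, true_and, Finset.mem_insert, Finset.mem_union]
    constructor
    · intro h
      rcases Nat.eq_zero_or_pos i.val with h' | h'
      · have := h0 h'
        subst this
        rw [hz] at h
        simp [h]
      · rcases lt_trichotomy i.val (m + 1) with h'' | h'' | h''
        · exact Or.inr (Or.inr ⟨h', h'', h⟩)
        · exact Or.inl (hp h'')
        · have := hl (by omega)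
          subst this
          exact absurd h hirr
    · rintro (h | h | h)
      · rw [h]; exact hpen
      · split_ifs at h with hx
        · rw [Finset.mem_singleton.1 h, hz]; exact hx
        · simp at h
      · exact h.2.2
  rw [hsplit, Finset.card_insert_of_notMem, Finset.card_union_of_disjoint] at h3'
  · split_ifs at h3' ⊢ <;> simp at h3' ⊢ <;> omega
  · split_ifs <;> simp
  · split_ifs <;> simp [Fin.ext_iff]

/-- Thomassen's form of the lollipop argument: the number of threaded paths which close up to a
Hamilton cycle is even. -/
lemma even_ncard_closable [Fintype V]
    (hA : ∀ a ∈ A, ∀ b ∈ A, ¬ H.Adj a b)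
    (hdeg : ∀ a ∈ A, ∀ u, H.Adj a u → (H.neighborSet u).ncard = 3) :
    Even {P : Fin (m + 3) ≃ V | IsThreadedPath H A x y P ∧ H.Adj (P (Fin.last _)) x}.ncard := by
  classical
  have hinv : ∑ q ∈ (Finset.univ.filter fun P : Fin (m + 3) ≃ V =>
      IsThreadedPath H A x y P).sigma (fun P => Finset.univ.filter fun i : Fin (m + 3) =>
        0 < i.val ∧ i.val < m + 1 ∧ H.Adj (P (Fin.last _)) (P i)), (1 : ZMod 2) = 0 := by
    refine Finset.sum_involution (fun q _ => ⟨(reverseAfter q.2).trans q.1, q.2⟩) ?_ ?_ ?_ ?_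
    · intro _ _
      decide
    · rintro ⟨P, i⟩ hq - heq
      simp only [Finset.mem_sigma, Finset.mem_filter, Finset.mem_univ, true_and] at hq
      have h1 : (reverseAfter i).trans P = P := by simpa using congrArg Sigma.fst heq
      have h2 : reverseAfter i (Fin.last _) = Fin.last _ :=
        P.injective (by simpa using DFunLike.congr_fun h1 (Fin.last _))
      have h3 := congrArg Fin.val h2
      rw [reverseAfter_val, if_neg] at h3 <;> simp at * <;> omega
    · rintro ⟨P, i⟩ hq
      simp only [Finset.mem_sigma, Finset.mem_filter, Finset.mem_univ, true_and] at hq ⊢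
      obtain ⟨hP, hi₀, hi, h⟩ := hq
      refine ⟨hP.rotate hA hi₀ hi h, hi₀, hi, ?_⟩
      have h2 : reverseAfter i i = i := by ext; simp [reverseAfter_val]
      simp only [Equiv.trans_apply, h2]
      refine (hP.adj _ _ ?_).symm
      rw [reverseAfter_val, if_neg] <;> simp <;> omega
    · rintro ⟨P, i⟩ hq
      simp only [Sigma.mk.injEq, heq_eq_eq, and_true]
      ext j
      simp [reverseAfter_reverseAfter]
  rw [Finset.sum_sigma] at hinv
  have hcard : ∀ P ∈ Finset.univ.filter fun P : Fin (m + 3) ≃ V => IsThreadedPath H A x y P,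
      (∑ _i ∈ Finset.univ.filter fun i : Fin (m + 3) =>
        0 < i.val ∧ i.val < m + 1 ∧ H.Adj (P (Fin.last _)) (P i), (1 : ZMod 2)) =
      if H.Adj (P (Fin.last _)) x then 1 else 0 := by
    intro P hP
    have := (Finset.mem_filter.1 hP).2.card_rotations hdeg
    rw [Finset.sum_const, nsmul_eq_mul, mul_one]
    generalize Finset.card _ = c at this ⊢
    split_ifs at this ⊢
    · obtain rfl : c = 1 := by omega
      rfl
    · obtain rfl : c = 2 := by omega
      rfl
  rw [Finset.sum_congr rfl hcard, ← Finset.sum_filter, Finset.filter_filter, Finset.sum_const,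
    nsmul_eq_mul, mul_one] at hinv
  rw [Set.ncard_eq_toFinset_card', Set.toFinset_ofPred]
  exact (ZMod.natCast_eq_zero_iff_even).1 hinv

end Parity

lemma cycleGraph_adj_val {m : ℕ} {i j : Fin (m + 3)} :
    (SimpleGraph.cycleGraph (m + 3)).Adj i j ↔
      i.val + 1 = j.val ∨ j.val + 1 = i.val ∨ (i = 0 ∧ j = Fin.last _) ∨
        (j = 0 ∧ i = Fin.last _) := by
  have := i.isLt
  have := j.isLt
  rw [SimpleGraph.cycleGraph_adj']
  simp only [Fin.ext_iff, Fin.val_last, Fin.val_zero, Fin.val_sub]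
  have key : ∀ a b : ℕ, a < m + 3 → b < m + 3 →
      ((m + 3 - b + a) % (m + 3) = 1 ↔ b + 1 = a ∨ (b = m + 2 ∧ a = 0)) := by
    intro a b ha hb
    rcases lt_or_ge (m + 3 - b + a) (m + 3) with h | h
    · rw [Nat.mod_eq_of_lt h]
      omega
    · rw [Nat.mod_eq_sub_mod h, Nat.mod_eq_of_lt (by omega)]
      omega
  rw [key _ _ (by omega) (by omega), key _ _ (by omega) (by omega)]
  omega

/-- The Hamilton cycle visiting the vertices in the order given by `P`. -/
def cycleOf {V : Type*} {m : ℕ} (P : Fin (m + 3) ≃ V) : SimpleGraph V :=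
  (SimpleGraph.cycleGraph (m + 3)).comap P.symm

section Cycle

variable {V : Type*} {m : ℕ}

lemma cycleOf_adj (P : Fin (m + 3) ≃ V) (i j : Fin (m + 3)) :
    (cycleOf P).Adj (P i) (P j) ↔ (SimpleGraph.cycleGraph (m + 3)).Adj i j := by
  simp [cycleOf]

lemma isHamCycleOn_cycleOf (P : Fin (m + 3) ≃ V) : IsHamCycleOn (cycleOf P) := by
  let φ : cycleOf P ≃g SimpleGraph.cycleGraph (m + 3) := SimpleGraph.Iso.comap P.symm _
  refine ⟨φ.connected_iff.2 SimpleGraph.cycleGraph_connected, fun v => ?_⟩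
  have h := SimpleGraph.cycleGraph_degree_three_le (n := m) (v := P.symm v)
  rw [← SimpleGraph.card_neighborSet_eq_degree, ← Nat.card_eq_fintype_card,
    Nat.card_coe_set_eq] at h
  refine Eq.trans ?_ h
  rw [← Set.ncard_image_of_injective _ P.symm.injective]
  congr 1
  ext i
  simp only [Set.mem_image, SimpleGraph.mem_neighborSet]
  exact ⟨fun ⟨w, hw, hi⟩ => hi ▸ hw, fun hi => ⟨P i, by simpa [cycleOf] using hi, by simp⟩⟩

lemma eq_of_le_of_isHamCycleOn {C D : SimpleGraph V} (hC : IsHamCycleOn C) (hD : IsHamCycleOn D)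
    (h : C ≤ D) : C = D := by
  refine le_antisymm h fun u v huv => ?_
  have hfin : (D.neighborSet u).Finite := Set.finite_of_ncard_ne_zero (by rw [hD.2 u]; decide)
  have := Set.eq_of_subset_of_ncard_le (s := C.neighborSet u) (t := D.neighborSet u)
    (fun w (hw : C.Adj u w) => h hw) (by rw [hC.2 u, hD.2 u]) hfin
  change v ∈ C.neighborSet u
  rw [this]
  exact huv

lemma IsHamCycleOn.exists_eq_cycleOf [Fintype V] {C : SimpleGraph V} (hC : IsHamCycleOn C)
    (hV : Fintype.card V = m + 3) (x : V) : ∃ P : Fin (m + 3) ≃ V, P 0 = x ∧ C = cycleOf P := by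
  classical
  have hcyc : C.IsCycles := fun v _ => hC.2 v
  obtain ⟨p, hp, hverts⟩ := hcyc.exists_cycle_toSubgraph_verts_eq_connectedComponentSupp
    (c := C.connectedComponentMk x) (v := x) rfl
    (Set.nonempty_of_ncard_ne_zero (by rw [hC.2 x]; decide))
  have hmem : ∀ v, v ∈ p.support := by
    intro v
    rw [← SimpleGraph.Walk.mem_verts_toSubgraph, hverts]
    exact SimpleGraph.ConnectedComponent.sound (hC.1.preconnected v x)
  have hham : p.IsHamiltonianCycle := by
    refine SimpleGraph.Walk.isHamiltonianCycle_iff_isCycle_and_support_count_tail_eq_one.2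
      ⟨hp, fun v => List.count_eq_one_of_mem hp.support_nodup ?_⟩
    rcases SimpleGraph.Walk.mem_support_iff p |>.1 (hmem v) with h | h
    · rw [h]
      exact SimpleGraph.Walk.end_mem_tail_support hp.not_nil
    · exact h
  have hlen : p.length = m + 3 := hham.length_eq.trans hV
  have hinj : Function.Injective fun i : Fin (m + 3) => p.getVert i.val := by
    intro i j hij
    have := i.isLt
    have := j.isLt
    exact Fin.ext (hp.getVert_injOn' (by simp only [Set.mem_ofPred_eq]; omega)
      (by simp only [Set.mem_ofPred_eq]; omega) hij)
  let P : Fin (m + 3) ≃ V := Equiv.ofBijective _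
    ((Fintype.bijective_iff_injective_and_card _).2 ⟨hinj, by simp [hV]⟩)
  have hP : ∀ i, P i = p.getVert i.val := fun _ => rfl
  refine ⟨P, by simp [hP], (eq_of_le_of_isHamCycleOn (isHamCycleOn_cycleOf P) hC ?_).symm⟩
  have hstep : ∀ i j : Fin (m + 3), i.val + 1 = j.val → C.Adj (P i) (P j) := by
    intro i j hij
    rw [hP, hP, ← hij]
    exact p.adj_getVert_succ (by omega)
  have hclose : C.Adj (P (Fin.last _)) (P 0) := by
    have h := p.adj_getVert_succ (i := m + 2) (by omega)
    rw [show m + 2 + 1 = p.length by omega, SimpleGraph.Walk.getVert_length] at h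
    simpa [hP] using h
  intro u v huv
  obtain ⟨i, rfl⟩ := P.surjective u
  obtain ⟨j, rfl⟩ := P.surjective v
  rw [cycleOf_adj, cycleGraph_adj_val] at huv
  rcases huv with h | h | ⟨rfl, rfl⟩ | ⟨rfl, rfl⟩
  · exact hstep _ _ h
  · exact (hstep _ _ h).symm
  · exact hclose.symm
  · exact hclose

lemma cycleOf_injective {P Q : Fin (m + 3) ≃ V} (h0 : P 0 = Q 0) (h1 : P 1 = Q 1)
    (h : cycleOf P = cycleOf Q) : P = Q := by
  have key : ∀ k : ℕ, ∀ hk : k + 1 < m + 3,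
      P ⟨k, by omega⟩ = Q ⟨k, by omega⟩ ∧ P ⟨k + 1, hk⟩ = Q ⟨k + 1, hk⟩ := by
    intro k
    induction k with
    | zero => exact fun _ => ⟨h0, h1⟩
    | succ k ih =>
      intro hk
      obtain ⟨ih₀, ih₁⟩ := ih (by omega)
      refine ⟨ih₁, ?_⟩
      have hadj : (cycleOf P).Adj (P ⟨k + 1, by omega⟩) (P ⟨k + 1 + 1, hk⟩) := by
        rw [cycleOf_adj, cycleGraph_adj_val]
        exact Or.inl rfl
      obtain ⟨j, hj⟩ := Q.surjective (P ⟨k + 1 + 1, hk⟩)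
      rw [h, ih₁, ← hj, cycleOf_adj, cycleGraph_adj_val] at hadj
      have hne : j.val ≠ k := by
        intro hjk
        have : j = ⟨k, by omega⟩ := Fin.ext hjk
        rw [this, ← ih₀] at hj
        have := congrArg Fin.val (P.injective hj)
        simp at this
        omega
      rw [← hj]
      congr 1
      simp only [Fin.ext_iff, Fin.val_last, Fin.val_zero] at hadj ⊢
      omega
  ext i
  rcases Nat.eq_zero_or_pos i.val with hi | hi
  · rw [show i = 0 from Fin.ext hi, h0]
  · have := (key (i.val - 1) (by omega)).2
    simpa only [Nat.sub_add_cancel hi] using this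

/-- Thomassen's criterion: a set `A` that is independent in the Hamilton cycle `C`, and such that
every `C`-neighbour of `A` has a neighbour in `A` off the cycle, yields a second Hamilton cycle
through all edges of `C` that avoid `A`. -/
theorem IsHamCycleOn.exists_ne [Fintype V] {G C : SimpleGraph V} (hC : IsHamCycleOn C)
    (hV : Fintype.card V = m + 3) {A : Set V} (hne : A.Nonempty)
    (hA : ∀ a ∈ A, ∀ b ∈ A, ¬ C.Adj a b)
    (hdom : ∀ a ∈ A, ∀ u, C.Adj a u → ∃ b ∈ A, G.Adj u b ∧ ¬ C.Adj u b) :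
    ∃ C' : SimpleGraph V, C' ≤ G ⊔ C ∧ IsHamCycleOn C' ∧ C' ≠ C ∧
      ∀ u v, u ∉ A → v ∉ A → C.Adj u v → C'.Adj u v := by
  have hg : ∀ u, ∃ b, (∃ a ∈ A, C.Adj a u) → b ∈ A ∧ G.Adj u b ∧ ¬ C.Adj u b := by
    intro u
    by_cases hu : ∃ a ∈ A, C.Adj a u
    · obtain ⟨a, ha, hau⟩ := hu
      obtain ⟨b, hb⟩ := hdom a ha u hau
      exact ⟨b, fun _ => hb⟩
    · exact ⟨u, fun h => absurd h hu⟩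
  choose g hg using hg
  have hD : ∀ u, (∃ a ∈ A, C.Adj a u) → u ∉ A := fun u ⟨a, ha, h⟩ hu => hA a ha u hu h
  let H : SimpleGraph V := C ⊔ SimpleGraph.fromRel fun u b => (∃ a ∈ A, C.Adj a u) ∧ b = g u
  have hH : ∀ u v, H.Adj u v ↔ C.Adj u v ∨ ((∃ a ∈ A, C.Adj a u) ∧ v = g u) ∨
      ((∃ a ∈ A, C.Adj a v) ∧ u = g v) := by
    intro u v
    simp only [H, SimpleGraph.sup_adj, SimpleGraph.fromRel_adj]
    constructor
    · rintro (h | ⟨-, h⟩)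
      · exact Or.inl h
      · exact Or.inr h
    · rintro (h | h)
      · exact Or.inl h
      · refine Or.inr ⟨?_, h⟩
        rintro rfl
        rcases h with ⟨h, h'⟩ | ⟨h, h'⟩ <;> exact hD _ h (h' ▸ (hg _ h).1)
  have hHG : H ≤ G ⊔ C := by
    intro u v huv
    rcases (hH u v).1 huv with h | ⟨h, rfl⟩ | ⟨h, rfl⟩
    · exact Or.inr h
    · exact Or.inl (hg _ h).2.1
    · exact Or.inl (hg _ h).2.1.symm
  have hHA : ∀ a ∈ A, ∀ u, H.Adj a u → ∃ b ∈ A, C.Adj b u := by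
    intro a ha u hau
    rcases (hH a u).1 hau with h | ⟨h, -⟩ | ⟨h, -⟩
    · exact ⟨a, ha, h⟩
    · exact absurd ha (hD _ h)
    · exact h
  have hHi : ∀ a ∈ A, ∀ b ∈ A, ¬ H.Adj a b := fun a ha b hb h => hD _ (hHA a ha b h) hb
  have hdeg : ∀ a ∈ A, ∀ u, H.Adj a u → (H.neighborSet u).ncard = 3 := by
    intro a ha u hau
    have hu := hHA a ha u hau
    have : H.neighborSet u = insert (g u) (C.neighborSet u) := by
      ext v
      simp only [SimpleGraph.mem_neighborSet, hH, Set.mem_insert_iff]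
      constructor
      · rintro (h | ⟨-, h⟩ | ⟨h, rfl⟩)
        · exact Or.inr h
        · exact Or.inl h
        · exact absurd (hg _ h).1 (hD _ hu)
      · rintro (h | h)
        · exact Or.inr (Or.inl ⟨hu, h⟩)
        · exact Or.inl h
    rw [this, Set.ncard_insert_of_notMem (s := C.neighborSet u) (hg u hu).2.2 (Set.toFinite _), hC.2 u]
  obtain ⟨x, hx⟩ := hne
  obtain ⟨P, hP0, hCP⟩ := hC.exists_eq_cycleOf hV x
  have hCadj : ∀ i j, C.Adj (P i) (P j) ↔ (SimpleGraph.cycleGraph (m + 3)).Adj i j := by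
    intro i j
    rw [hCP, cycleOf_adj]
  have hxl : C.Adj x (P (Fin.last _)) := by
    rw [← hP0, hCadj, cycleGraph_adj_val]
    simp
  have hHnA : ∀ u v, H.Adj u v → u ∉ A → v ∉ A → C.Adj u v := by
    intro u v huv hu hv
    rcases (hH u v).1 huv with h | ⟨h, rfl⟩ | ⟨h, rfl⟩
    · exact h
    · exact absurd (hg _ h).1 hv
    · exact absurd (hg _ h).1 hu
  have hP : IsThreadedPath H A x (P 1) P := by
    refine ⟨hP0, rfl, ⟨x, hx, Or.inl hxl⟩, fun i j hij => Or.inl ?_, fun i j hij hi hj => ?_⟩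
    · rw [hCadj, cycleGraph_adj_val]
      exact Or.inl hij
    · have := hHnA _ _ hij hi hj
      rw [hCadj, cycleGraph_adj_val] at this
      rcases this with h | h | ⟨rfl, -⟩ | ⟨rfl, -⟩
      · exact Or.inl h
      · exact Or.inr h
      · exact absurd (hP0 ▸ hx) hi
      · exact absurd (hP0 ▸ hx) hj
  have hpos := (Set.ncard_pos (Set.toFinite _)).2 (show {P' : Fin (m + 3) ≃ V |
      IsThreadedPath H A x (P 1) P' ∧ H.Adj (P' (Fin.last _)) x}.Nonempty from
    ⟨P, hP, Or.inl hxl.symm⟩)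
  obtain ⟨k, hk⟩ := even_ncard_closable (m := m) (x := x) (y := P 1) hHi hdeg
  obtain ⟨Q, ⟨hQ, hQx⟩, hQP⟩ := Set.exists_ne_of_one_lt_ncard
    (lt_of_le_of_ne (Nat.succ_le_of_lt hpos) (by rw [hk]; omega)) P
  refine ⟨cycleOf Q, le_trans ?_ hHG, isHamCycleOn_cycleOf Q, ?_, ?_⟩
  · intro u v huv
    obtain ⟨i, rfl⟩ := Q.surjective u
    obtain ⟨j, rfl⟩ := Q.surjective v
    rw [cycleOf_adj, cycleGraph_adj_val] at huv
    rcases huv with h | h | ⟨rfl, rfl⟩ | ⟨rfl, rfl⟩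
    · exact hQ.adj _ _ h
    · exact (hQ.adj _ _ h).symm
    · rw [hQ.zero]
      exact hQx.symm
    · rw [hQ.zero]
      exact hQx
  · intro h
    exact hQP (cycleOf_injective (hQ.zero.trans hP0.symm) hQ.one (h.trans hCP))
  · intro u v hu hv huv
    obtain ⟨i, rfl⟩ := Q.surjective u
    obtain ⟨j, rfl⟩ := Q.surjective v
    rw [cycleOf_adj, cycleGraph_adj_val]
    rcases hQ.edge i j (Or.inl huv) hu hv with h | h
    · exact Or.inl h
    · exact Or.inr (Or.inl h)

end Cycle

open scoped Classical in
/-- Greedy choice of a `C`-independent set meeting almost all members of a family of large sets. -/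
lemma exists_indep_card_disjoint_le {V : Type*} [Fintype V] (C : SimpleGraph V)
    (hC : ∀ v, (C.neighborSet v).ncard ≤ 2) (I : Finset V) (S : V → Finset V) {d : ℝ}
    (hd : 0 < d) (hdn : d ≤ 2 * Fintype.card V) (hS : ∀ v ∈ I, d ≤ (S v).card) (t : ℕ)
    (ht : 4 * (t : ℝ) ≤ d) :
    ∃ A : Finset V, A.card ≤ t ∧ (∀ a ∈ A, ∀ b ∈ A, ¬ C.Adj a b) ∧
      (∀ a ∈ A, ∃ v ∈ I, a ∈ S v) ∧
      ((I.filter fun v => Disjoint (S v) A).card : ℝ) ≤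
        Fintype.card V * (1 - d / (2 * Fintype.card V)) ^ t := by
  have hn : (0 : ℝ) < Fintype.card V := by linarith
  have hq : 0 ≤ 1 - d / (2 * Fintype.card V) := by
    rw [sub_nonneg, div_le_one (by positivity)]
    exact hdn
  induction t with
  | zero =>
    refine ⟨∅, by simp, by simp, by simp, ?_⟩
    simpa using Finset.card_le_univ I
  | succ t ih =>
    push_cast at ht
    obtain ⟨A, hAt, hAi, hAS, hAU⟩ := ih (by linarith)
    set U := I.filter fun v => Disjoint (S v) A with hU
    rcases U.eq_empty_or_nonempty with hUe | hUne
    · refine ⟨A, by omega, hAi, hAS, ?_⟩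
      rw [← hU, hUe]
      simp only [Finset.card_empty, Nat.cast_zero]
      positivity
    let T : Finset V := A.biUnion fun a => Finset.univ.filter fun w => C.Adj a w
    have hT : T.card ≤ A.card * 2 := Finset.card_biUnion_le_card_mul _ _ _ fun a _ => by
      rw [← Set.ncard_coe_finset]
      simpa [SimpleGraph.neighborSet] using hC a
    have hT' : (T.card : ℝ) ≤ 2 * t := by
      have : T.card ≤ 2 * t := by omega
      exact_mod_cast this
    have hlarge : ∀ v ∈ U, d / 2 ≤ ((S v \ T).card : ℝ) := by
      intro v hv
      have h₁ := hS v (Finset.mem_filter.1 hv).1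
      have h₂ : (S v).card ≤ (S v \ T).card + T.card := by
        have := Finset.le_card_sdiff T (S v)
        omega
      have h₃ : ((S v).card : ℝ) ≤ (S v \ T).card + T.card := by exact_mod_cast h₂
      linarith
    have hcount : (∑ v ∈ U, ((S v \ T).card : ℝ)) =
        ∑ w : V, ((U.filter fun v => w ∈ S v \ T).card : ℝ) := by
      have := Finset.sum_card_bipartiteAbove_eq_sum_card_bipartiteBelow
        (s := U) (t := Finset.univ) (fun v w => w ∈ S v \ T)
      simp only [Finset.bipartiteAbove, Finset.bipartiteBelow, Finset.filter_univ_mem] at this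
      exact_mod_cast this
    have : Nonempty V := hUne.to_type
    obtain ⟨w, -, hw⟩ := Finset.exists_le_of_sum_le
      (f := fun _ : V => (U.card : ℝ) * (d / (2 * Fintype.card V)))
      (g := fun w => ((U.filter fun v => w ∈ S v \ T).card : ℝ)) Finset.univ_nonempty (by
        rw [← hcount]
        refine le_trans (le_of_eq ?_) (Finset.card_nsmul_le_sum U _ _ hlarge)
        rw [Finset.sum_const, Finset.card_univ, nsmul_eq_mul, nsmul_eq_mul]
        field_simp)
    have hUpos : (0 : ℝ) < U.card := by exact_mod_cast hUne.card_pos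
    have hfib : 0 < (U.filter fun v => w ∈ S v \ T).card := by
      have : (0 : ℝ) < (U.filter fun v => w ∈ S v \ T).card := lt_of_lt_of_le (by positivity) hw
      exact_mod_cast this
    obtain ⟨v₀, hv₀⟩ := Finset.card_pos.1 hfib
    obtain ⟨hv₀U, hwv₀⟩ := Finset.mem_filter.1 hv₀
    obtain ⟨hwS, hwT⟩ := Finset.mem_sdiff.1 hwv₀
    have hwA : ∀ a ∈ A, ¬ C.Adj a w := fun a ha h =>
      hwT (Finset.mem_biUnion.2 ⟨a, ha, by simpa using h⟩)
    refine ⟨insert w A, (Finset.card_insert_le _ _).trans (by omega), ?_, ?_, ?_⟩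
    · intro a ha b hb
      rcases Finset.mem_insert.1 ha with ha | ha <;> rcases Finset.mem_insert.1 hb with hb | hb
      · rw [ha, hb]
        exact C.irrefl
      · rw [ha]
        exact fun h => hwA b hb h.symm
      · rw [hb]
        exact hwA a ha
      · exact hAi a ha b hb
    · intro a ha
      rcases Finset.mem_insert.1 ha with rfl | ha
      · exact ⟨v₀, (Finset.mem_filter.1 hv₀U).1, hwS⟩
      · exact hAS a ha
    · have hsub : (I.filter fun v => Disjoint (S v) (insert w A)) ⊆
          U \ U.filter fun v => w ∈ S v \ T := by
        intro v hv
        obtain ⟨hvI, hvd⟩ := Finset.mem_filter.1 hv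
        rw [Finset.disjoint_insert_right] at hvd
        refine Finset.mem_sdiff.2 ⟨Finset.mem_filter.2 ⟨hvI, hvd.2⟩, fun h => hvd.1 ?_⟩
        exact (Finset.mem_sdiff.1 (Finset.mem_filter.1 h).2).1
      have h₁ := Finset.card_le_card hsub
      have h₂ := Finset.card_sdiff_add_card_eq_card
        (Finset.filter_subset (fun v => w ∈ S v \ T) U)
      have h₃ : ((I.filter fun v => Disjoint (S v) (insert w A)).card : ℝ) +
          (U.filter fun v => w ∈ S v \ T).card ≤ U.card := by
        have : (I.filter fun v => Disjoint (S v) (insert w A)).card +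
          (U.filter fun v => w ∈ S v \ T).card ≤ U.card := by omega
        exact_mod_cast this
      calc ((I.filter fun v => Disjoint (S v) (insert w A)).card : ℝ)
          ≤ U.card * (1 - d / (2 * Fintype.card V)) := by linarith
        _ ≤ (Fintype.card V * (1 - d / (2 * Fintype.card V)) ^ t) *
            (1 - d / (2 * Fintype.card V)) := by gcongr
        _ = _ := by ring

lemma mul_one_sub_pow_lt_one {n d : ℝ} (hn : 0 < n) (hlog : 3 ≤ Real.log n)
    (hd : √n * Real.log n ^ 2 ≤ d) (hdn : d ≤ 2 * n) :
    n * (1 - d / (2 * n)) ^ ⌊d / 4⌋₊ < 1 := by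
  have hn1 : 1 ≤ n := by
    by_contra! h
    have := Real.log_nonpos hn.le h.le
    linarith
  have hs : 1 ≤ √n := Real.one_le_sqrt.2 hn1
  have hd9 : 9 ≤ d := by nlinarith
  have hfloor : d / 8 ≤ (⌊d / 4⌋₊ : ℝ) := by
    have := Nat.lt_floor_add_one (d / 4)
    linarith
  have hsq : n * Real.log n ^ 4 ≤ d ^ 2 := by
    have := pow_le_pow_left₀ (by positivity) hd 2
    rw [mul_pow, Real.sq_sqrt hn.le] at this
    linarith [this]
  have hexp : Real.log n < d / (2 * n) * ⌊d / 4⌋₊ := by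
    have h₁ : d / (2 * n) * (d / 8) ≤ d / (2 * n) * ⌊d / 4⌋₊ := by gcongr
    refine lt_of_lt_of_le ?_ h₁
    have h₂ : Real.log n * 27 ≤ Real.log n ^ 4 := by
      have : (3 : ℝ) ^ 3 ≤ Real.log n ^ 3 := pow_le_pow_left₀ (by norm_num) hlog 3
      nlinarith
    have h₃ : d / (2 * n) * (d / 8) = d ^ 2 / (16 * n) := by field_simp; norm_num
    rw [h₃, lt_div_iff₀ (by positivity)]
    nlinarith
  have hpow : (1 - d / (2 * n)) ^ ⌊d / 4⌋₊ ≤ Real.exp (-(d / (2 * n) * ⌊d / 4⌋₊)) := by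
    have h₀ : 0 ≤ 1 - d / (2 * n) := by
      rw [sub_nonneg, div_le_one (by positivity)]
      exact hdn
    calc (1 - d / (2 * n)) ^ ⌊d / 4⌋₊ ≤ Real.exp (-(d / (2 * n))) ^ ⌊d / 4⌋₊ :=
          pow_le_pow_left₀ h₀ (Real.one_sub_le_exp_neg _) _
      _ = _ := by rw [← Real.exp_nat_mul]; ring_nf
  calc n * (1 - d / (2 * n)) ^ ⌊d / 4⌋₊
      ≤ n * Real.exp (-(d / (2 * n) * ⌊d / 4⌋₊)) := by gcongr
    _ < n * Real.exp (-Real.log n) := by gcongr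
    _ = 1 := by rw [Real.exp_neg, Real.exp_log hn, mul_inv_cancel₀ hn.ne']

lemma three_le_log_of_le {x : ℝ} (hx : 27 ≤ x) : 3 ≤ Real.log x := by
  rw [Real.le_log_iff_exp_le (by linarith)]
  refine le_trans ?_ hx
  have h := pow_le_pow_left₀ (Real.exp_pos 1).le Real.exp_one_lt_three.le 3
  rw [← Real.exp_nat_mul] at h
  norm_num at h
  exact h

/-- A `C`-independent transversal of a family of at least `√n (log n) ^ 2`-element sets. -/
lemma exists_indep_transversal {V : Type*} [Fintype V] (C : SimpleGraph V)
    (hC : ∀ v, (C.neighborSet v).ncard ≤ 2) (hV : 27 ≤ Fintype.card V) {I : Finset V}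
    (hI : I.Nonempty) (S : V → Finset V)
    (hS : ∀ v ∈ I, √(Fintype.card V) * Real.log (Fintype.card V) ^ 2 ≤ (S v).card) :
    ∃ A : Finset V, (∀ a ∈ A, ∀ b ∈ A, ¬ C.Adj a b) ∧ (∀ a ∈ A, ∃ v ∈ I, a ∈ S v) ∧
      ∀ v ∈ I, ∃ a ∈ A, a ∈ S v := by
  classical
  have hlog : 3 ≤ Real.log (Fintype.card V) := three_le_log_of_le (by exact_mod_cast hV)
  have hn : (0 : ℝ) < Fintype.card V := by exact_mod_cast (by omega : 0 < Fintype.card V)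
  set d := √(Fintype.card V) * Real.log (Fintype.card V) ^ 2 with hd
  have hd0 : 0 < d := by positivity
  have hdn : d ≤ 2 * Fintype.card V := by
    obtain ⟨v, hv⟩ := hI
    have : ((S v).card : ℝ) ≤ Fintype.card V := by exact_mod_cast Finset.card_le_univ (S v)
    linarith [hS v hv]
  obtain ⟨A, -, hAi, hAS, hAU⟩ := exists_indep_card_disjoint_le C hC I S hd0 hdn hS ⌊d / 4⌋₊ (by
    linarith [Nat.floor_le (show 0 ≤ d / 4 by positivity)])
  have hlt := hAU.trans_lt (mul_one_sub_pow_lt_one hn hlog le_rfl hdn)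
  rw [Nat.cast_lt_one, Finset.card_eq_zero, Finset.filter_eq_empty_iff] at hlt
  refine ⟨A, hAi, hAS, fun v hv => ?_⟩
  obtain ⟨a, ha, haA⟩ := Finset.not_disjoint_iff.1 (hlt hv)
  exact ⟨a, haA, ha⟩

open scoped Classical in
lemma ncard_neighborSet_le {V : Type*} [Fintype V] {G C : SimpleGraph V}
    (hC : ∀ v, (C.neighborSet v).ncard ≤ 2) (B : Set V) (v : V) :
    (G.neighborSet v).ncard ≤ (Finset.univ.filter fun w =>
      G.Adj v w ∧ ¬ C.Adj v w ∧ w ∉ B ∧ ∀ b ∈ B, ¬ C.Adj b w).card + 3 * B.ncard + 2 := by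
  have hT : (B.toFinset.biUnion fun b => (C.neighborSet b).toFinset).card ≤ B.ncard * 2 := by
    rw [Set.ncard_eq_toFinset_card']
    refine Finset.card_biUnion_le_card_mul _ _ _ fun b _ => ?_
    rw [← Set.ncard_eq_toFinset_card']
    exact hC b
  have hv := hC v
  have hsub : (G.neighborSet v).toFinset ⊆ (Finset.univ.filter fun w =>
      G.Adj v w ∧ ¬ C.Adj v w ∧ w ∉ B ∧ ∀ b ∈ B, ¬ C.Adj b w) ∪ (B.toFinset ∪
        ((B.toFinset.biUnion fun b => (C.neighborSet b).toFinset) ∪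
          (C.neighborSet v).toFinset)) := by
    intro w hw
    simp only [Set.mem_toFinset, SimpleGraph.mem_neighborSet, Finset.mem_union, Finset.mem_filter,
      Finset.mem_univ, true_and, Finset.mem_biUnion] at hw ⊢
    by_contra! h
    exact (h.1 hw h.2.2.2 h.2.1).elim fun b hb => h.2.2.1 b hb.1 hb.2
  have h₁ := (Finset.card_le_card hsub).trans (Finset.card_union_le _ _)
  have h₂ := Finset.card_union_le B.toFinset
    ((B.toFinset.biUnion fun b => (C.neighborSet b).toFinset) ∪ (C.neighborSet v).toFinset)
  have h₃ := Finset.card_union_le (B.toFinset.biUnion fun b => (C.neighborSet b).toFinset)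
    (C.neighborSet v).toFinset
  simp only [← Set.ncard_eq_toFinset_card'] at h₁ h₂ h₃
  omega

theorem stmt2 :
    ∃ n₀ : ℕ, ∀ n : ℕ, n₀ ≤ n → ∀ G C : SimpleGraph (Fin n), IsHamCycleOn C →
      ∀ (E : Set (Sym2 (Fin n))) (B : Set (Fin n)), E ⊆ C.edgeSet →
        B ∪ {v : Fin n | ∃ e ∈ E, v ∈ e} ≠ Set.univ →
        (∀ v : Fin n, v ∉ B ∪ {v : Fin n | ∃ e ∈ E, v ∈ e} →
          Real.sqrt n * (Real.log n) ^ 2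
              + 3 * ((B ∪ {v : Fin n | ∃ e ∈ E, v ∈ e}).ncard : ℝ) + 2
            ≤ ((G.neighborSet v).ncard : ℝ)) →
        ∃ C' : SimpleGraph (Fin n), C' ≤ G ⊔ C ∧ IsHamCycleOn C' ∧ C' ≠ C ∧
          E ⊆ C'.edgeSet := by
  classical
  refine ⟨27, fun n hn G C hC E B₀ hE hB hdeg => ?_⟩
  have hEB : ∀ e ∈ E, ∀ v ∈ e, v ∈ B₀ ∪ {v : Fin n | ∃ e ∈ E, v ∈ e} :=
    fun e he v hv => Or.inr ⟨e, he, hv⟩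
  generalize B₀ ∪ {v : Fin n | ∃ e ∈ E, v ∈ e} = B at hB hdeg hEB
  have hC2 : ∀ v, (C.neighborSet v).ncard ≤ 2 := fun v => (hC.2 v).le
  let I : Finset (Fin n) := Finset.univ.filter fun v => v ∉ B
  let S : Fin n → Finset (Fin n) := fun v => Finset.univ.filter fun w =>
    G.Adj v w ∧ ¬ C.Adj v w ∧ w ∉ B ∧ ∀ b ∈ B, ¬ C.Adj b w
  have hS : ∀ v ∈ I, √n * Real.log n ^ 2 ≤ ((S v).card : ℝ) := by
    intro v hv
    have h₁ := hdeg v (Finset.mem_filter.1 hv).2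
    have h₂ : (G.neighborSet v).ncard ≤ (S v).card + 3 * B.ncard + 2 := by
      convert ncard_neighborSet_le hC2 B v
    have h₃ : ((G.neighborSet v).ncard : ℝ) ≤ (S v).card + 3 * B.ncard + 2 := by
      exact_mod_cast h₂
    linarith
  obtain ⟨v₀, hv₀⟩ := (Set.ne_univ_iff_exists_notMem B).1 hB
  obtain ⟨A, hAi, hAS, hdom⟩ := exists_indep_transversal C hC2 (by simpa using hn)
    (I := I) ⟨v₀, by simpa [I] using hv₀⟩ S (by simpa using hS)
  replace hdom : ∀ v, v ∉ B → ∃ a ∈ A, a ∈ S v := fun v hv => hdom v (by simpa [I] using hv)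
  have hAB : ∀ a ∈ A, a ∉ B ∧ ∀ b ∈ B, ¬ C.Adj b a := by
    intro a ha
    obtain ⟨v, -, hv⟩ := hAS a ha
    exact (Finset.mem_filter.1 hv).2.2.2
  obtain ⟨a₀, ha₀, -⟩ := hdom v₀ hv₀
  obtain ⟨C', hC'G, hC', hne, hkeep⟩ := hC.exists_ne (G := G) (m := n - 3) (A := (A : Set (Fin n)))
    (by rw [Fintype.card_fin]; omega) ⟨a₀, ha₀⟩ hAi (by
      intro a ha u hau
      obtain ⟨b, hb, hbS⟩ := hdom u fun hu => (hAB a ha).2 u hu hau.symm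
      have := (Finset.mem_filter.1 hbS).2
      exact ⟨b, hb, this.1, this.2.1⟩)
  refine ⟨C', hC'G, hC', hne, fun e he => ?_⟩
  have heC := hE he
  have heB := hEB e he
  induction e with
  | _ u v =>
    exact hkeep u v (fun h => (hAB u h).1 (heB u (Sym2.mem_mk_left u v)))
      (fun h => (hAB v h).1 (heB v (Sym2.mem_mk_right u v))) heC
end

section
/- Any drawing of an n-vertex graph with at least 3n + 1 edges contains three pairwise disconnected edges. -/
/-- A (straight-line) drawing of a graph `G` in the plane: an injective placement of the
vertices such that, for every edge `uv`, no other vertex lies on the line through the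
endpoints of the edge. -/
def IsDrawing {V : Type*} (G : SimpleGraph V) (f : V → ℝ × ℝ) : Prop :=
  Function.Injective f ∧
    ∀ u v w : V, G.Adj u v → w ≠ u → w ≠ v →
      f w ∉ (affineSpan ℝ ({f u, f v} : Set (ℝ × ℝ)) : Set (ℝ × ℝ))

/-- The edges `uv` and `xy` cross in the drawing `f`: their segments meet in a point which
is not a common endpoint of the two edges. -/
def CrossingEdges {V : Type*} (f : V → ℝ × ℝ) (u v x y : V) : Prop :=
  ∃ p : ℝ × ℝ, p ∈ segment ℝ (f u) (f v) ∧ p ∈ segment ℝ (f x) (f y) ∧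
    ¬ (p ∈ ({f u, f v} : Set (ℝ × ℝ)) ∧ p ∈ ({f x, f y} : Set (ℝ × ℝ)))

/-- The edges `uv` and `xy` are disconnected in the drawing `f`: they do not cross and
share no endpoint. -/
def DisconnectedEdges {V : Type*} (f : V → ℝ × ℝ) (u v x y : V) : Prop :=
  ¬ CrossingEdges f u v x y ∧ u ≠ x ∧ u ≠ y ∧ v ≠ x ∧ v ≠ y

/-- Twice the signed area of the triangle `p q r`: positive when `r` lies to the left of the
directed line `p q`. -/
def orient (p q r : ℝ × ℝ) : ℝ :=
  (q.1 - p.1) * (r.2 - p.2) - (q.2 - p.2) * (r.1 - p.1)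

lemma orient_rotate (p q r : ℝ × ℝ) : orient q r p = orient p q r := by
  simp only [orient]; ring

lemma orient_swap (p q r : ℝ × ℝ) : orient q p r = -orient p q r := by
  simp only [orient]; ring

lemma orient_swap_right (p q r : ℝ × ℝ) : orient p r q = -orient p q r := by
  simp only [orient]; ring

@[simp] lemma orient_self_left (p q : ℝ × ℝ) : orient p q p = 0 := by
  simp only [orient]; ring

@[simp] lemma orient_self (p q : ℝ × ℝ) : orient p p q = 0 := by
  simp only [orient]; ring

@[simp] lemma orient_self_right (p q : ℝ × ℝ) : orient p q q = 0 := by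
  simp only [orient]; ring

/-- Expressing `s` in barycentric coordinates with respect to `p`, `q`, `r`. -/
lemma orient_barycentric (u v p q r s : ℝ × ℝ) :
    orient p q r * orient u v s =
      orient q r s * orient u v p + orient r p s * orient u v q + orient p q s * orient u v r := by
  simp only [orient]; ring

/-- The Grassmann-Plücker relation. -/
lemma orient_plucker (p q r s t : ℝ × ℝ) :
    orient p q r * orient p s t - orient p q s * orient p r t +
      orient p q t * orient p r s = 0 := by
  simp only [orient]; ring

lemma orient_sum (p q r s : ℝ × ℝ) :
    orient p q r = orient q r s + orient r p s + orient p q s := by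
  simp only [orient]; ring

lemma orient_combo (u v p q : ℝ × ℝ) {s t : ℝ} (h : s + t = 1) :
    orient u v (s • p + t • q) = s * orient u v p + t * orient u v q := by
  obtain rfl : t = 1 - s := by linarith
  simp only [orient, Prod.fst_add, Prod.snd_add, Prod.smul_fst, Prod.smul_snd, smul_eq_mul]
  ring

lemma mem_affineSpan_pair_of_orient_eq_zero {p q r : ℝ × ℝ} (hpq : p ≠ q)
    (h : orient p q r = 0) : r ∈ affineSpan ℝ ({p, q} : Set (ℝ × ℝ)) := by
  have hpos : 0 < (q.1 - p.1) ^ 2 + (q.2 - p.2) ^ 2 := by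
    by_contra! hle
    refine hpq (Prod.ext ?_ ?_) <;> nlinarith [sq_nonneg (q.1 - p.1), sq_nonneg (q.2 - p.2)]
  have key : AffineMap.lineMap p q (((q.1 - p.1) * (r.1 - p.1) + (q.2 - p.2) * (r.2 - p.2)) /
      ((q.1 - p.1) ^ 2 + (q.2 - p.2) ^ 2)) = r := by
    simp only [orient] at h
    refine Prod.ext ?_ ?_ <;>
      simp only [AffineMap.lineMap_apply, vsub_eq_sub, vadd_eq_add, Prod.fst_add, Prod.snd_add,
        Prod.smul_fst, Prod.smul_snd, Prod.fst_sub, Prod.snd_sub, smul_eq_mul]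
    · field_simp
      linear_combination (q.2 - p.2) * h
    · field_simp
      linear_combination (-(q.1 - p.1)) * h
  rw [← key]
  exact AffineMap.lineMap_mem_affineSpan_pair _ _ _

/-- Two segments weakly separated by a line, each touching it in at most one endpoint, are
disjoint if these endpoints differ. -/
lemma disjoint_segment_of_orient {u v a b c d : ℝ × ℝ} (ha : orient u v a < 0)
    (hb : orient u v b ≤ 0) (hc : 0 ≤ orient u v c) (hd : 0 < orient u v d) (hbc : b ≠ c) :
    Disjoint (segment ℝ a b) (segment ℝ c d) := by
  rw [Set.disjoint_left]
  rintro p ⟨s, t, hs, ht, hst, rfl⟩ ⟨s', t', hs', ht', hst', he⟩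
  have h := congrArg (orient u v) he
  rw [orient_combo _ _ _ _ hst, orient_combo _ _ _ _ hst'] at h
  have h1 := mul_nonpos_of_nonneg_of_nonpos hs ha.le
  have h2 := mul_nonpos_of_nonneg_of_nonpos ht hb
  have h3 := mul_nonneg hs' hc
  have h4 := mul_nonneg ht' hd.le
  have hs0 : s = 0 := by
    rcases mul_eq_zero.1 (show s * orient u v a = 0 by linarith) with h | h
    · exact h
    · exact absurd h ha.ne
  have ht0 : t' = 0 := by
    rcases mul_eq_zero.1 (show t' * orient u v d = 0 by linarith) with h | h
    · exact h
    · exact absurd h hd.ne'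
  subst hs0 ht0
  obtain rfl : t = 1 := by linarith
  obtain rfl : s' = 1 := by linarith
  simp at he
  exact hbc he.symm

/-- Two segments are disjoint if one of them lies strictly on one side of a line and the other
weakly on the other side. -/
lemma disjoint_segment_of_orient_neg {u v a b c d : ℝ × ℝ} (ha : orient u v a < 0)
    (hb : orient u v b < 0) (hc : 0 ≤ orient u v c) (hd : 0 ≤ orient u v d) :
    Disjoint (segment ℝ a b) (segment ℝ c d) := by
  rw [Set.disjoint_left]
  rintro p ⟨s, t, hs, ht, hst, rfl⟩ ⟨s', t', hs', ht', hst', he⟩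
  have h := congrArg (orient u v) he
  rw [orient_combo _ _ _ _ hst, orient_combo _ _ _ _ hst'] at h
  have h3 := mul_nonneg hs' hc
  have h4 := mul_nonneg ht' hd
  have h5 := (convex_Iio (0 : ℝ)) ha hb hs ht hst
  simp only [smul_eq_mul, Set.mem_Iio] at h5
  linarith

section Drawing

variable {V : Type*} {G G₁ G₂ : SimpleGraph V} {f : V → ℝ × ℝ}

lemma IsDrawing.orient_ne_zero (hf : IsDrawing G f) {u v w : V} (h : G.Adj u v) (hu : w ≠ u)
    (hv : w ≠ v) : orient (f u) (f v) (f w) ≠ 0 := fun h0 =>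
  hf.2 u v w h hu hv (mem_affineSpan_pair_of_orient_eq_zero (fun e => h.ne (hf.1 e)) h0)

lemma disconnectedEdges_of_disjoint {u v x y : V}
    (h : Disjoint (segment ℝ (f u) (f v)) (segment ℝ (f x) (f y))) :
    DisconnectedEdges f u v x y := by
  have hne : ∀ {i j : V}, f i ∈ segment ℝ (f u) (f v) → f j ∈ segment ℝ (f x) (f y) → i ≠ j := by
    rintro i j hi hj rfl
    exact Set.disjoint_left.1 h hi hj
  have hu := left_mem_segment ℝ (f u) (f v)
  have hv := right_mem_segment ℝ (f u) (f v)
  have hx := left_mem_segment ℝ (f x) (f y)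
  have hy := right_mem_segment ℝ (f x) (f y)
  exact ⟨fun ⟨p, hp, hp', _⟩ => Set.disjoint_left.1 h hp hp', hne hu hx, hne hu hy, hne hv hx,
    hne hv hy⟩

lemma IsDrawing.anti {H : SimpleGraph V} (hf : IsDrawing G f) (h : H ≤ G) : IsDrawing H f :=
  ⟨hf.1, fun u v w huv => hf.2 u v w (h huv)⟩

/-- There are three edges of `G` which are drawn as pairwise disjoint segments. -/
def HasThreeDisjointEdges (G : SimpleGraph V) (f : V → ℝ × ℝ) : Prop :=
  ∃ u₁ v₁ u₂ v₂ u₃ v₃ : V, G.Adj u₁ v₁ ∧ G.Adj u₂ v₂ ∧ G.Adj u₃ v₃ ∧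
    Disjoint (segment ℝ (f u₁) (f v₁)) (segment ℝ (f u₂) (f v₂)) ∧
    Disjoint (segment ℝ (f u₁) (f v₁)) (segment ℝ (f u₃) (f v₃)) ∧
    Disjoint (segment ℝ (f u₂) (f v₂)) (segment ℝ (f u₃) (f v₃))

/-- Every edge of `H` has, at each of its endpoints, an edge of `G` on its left (if `σ = 1`) or
on its right (if `σ = -1`). -/
def HasTurns (σ : ℝ) (f : V → ℝ × ℝ) (G H : SimpleGraph V) : Prop :=
  ∀ u v : V, H.Adj u v → ∃ w, G.Adj u w ∧ 0 < σ * orient (f u) (f v) (f w)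

/-- Deleting at each vertex the extreme edge in one direction, if there is one, leaves a subgraph
in which every edge can be turned at both ends. -/
lemma IsDrawing.exists_hasTurns [Fintype V] (hf : IsDrawing G f) {σ : ℝ} (hσ : σ ≠ 0) :
    ∃ H ≤ G, HasTurns σ f G H ∧ G.edgeSet.ncard ≤ H.edgeSet.ncard + Fintype.card V := by
  classical
  let good : V → V → Prop := fun u v => ∃ w, G.Adj u w ∧ 0 < σ * orient (f u) (f v) (f w)
  let H : SimpleGraph V :=
    { Adj := fun u v => G.Adj u v ∧ good u v ∧ good v u
      symm := ⟨fun u v h => ⟨h.1.symm, h.2.2, h.2.1⟩⟩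
      loopless := ⟨fun u h => h.1.ne rfl⟩ }
  have huniq : ∀ u v w, G.Adj u v → ¬ good u v → G.Adj u w → ¬ good u w → v = w := by
    intro u v w hv hv' hw hw'
    by_contra hne
    have h0 := mul_ne_zero hσ (hf.orient_ne_zero hv hw.ne' (Ne.symm hne))
    rcases lt_or_gt_of_ne h0 with h | h
    · refine hw' ⟨v, hv, ?_⟩
      rw [orient_swap_right]
      linarith
    · exact hv' ⟨w, hw, h⟩
  refine ⟨H, fun u v h => h.1, fun u v h => h.2.1, ?_⟩
  let bad : V → Sym2 V := fun u =>
    if h : ∃ v, G.Adj u v ∧ ¬ good u v then s(u, h.choose) else s(u, u)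
  have hbad : ∀ u v, G.Adj u v → ¬ good u v → bad u = s(u, v) := by
    intro u v hv hv'
    have h : ∃ v, G.Adj u v ∧ ¬ good u v := ⟨v, hv, hv'⟩
    simp only [bad, dif_pos h]
    rw [huniq u v _ hv hv' h.choose_spec.1 h.choose_spec.2]
  have hsub : G.edgeSet ⊆ H.edgeSet ∪ Set.range bad := by
    intro e
    induction e using Sym2.ind with
    | h u v =>
      intro he
      rw [SimpleGraph.mem_edgeSet] at he
      by_cases h1 : good u v
      · by_cases h2 : good v u
        · exact Or.inl ⟨he, h1, h2⟩
        · exact Or.inr ⟨v, by rw [hbad v u he.symm h2, Sym2.eq_swap]⟩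
      · exact Or.inr ⟨u, hbad u v he h1⟩
  calc G.edgeSet.ncard ≤ (H.edgeSet ∪ Set.range bad).ncard := Set.ncard_le_ncard hsub
    _ ≤ H.edgeSet.ncard + (Set.range bad).ncard := Set.ncard_union_le _ _
    _ ≤ H.edgeSet.ncard + Fintype.card V := by
      gcongr
      rw [← Set.image_univ, ← Nat.card_eq_fintype_card, ← Set.ncard_univ]
      exact Set.ncard_image_le

/-- The zigzag `a x y b d`, in case the triangle `a y b` contains `x` and lies to the right of
`b d`. -/
lemma HasThreeDisjointEdges.of_triangle (hf : IsDrawing G f) (h₁ : HasTurns (-1) f G G₁)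
    {x y a b d : V} (hxa : G.Adj x a) (hyb : G.Adj y b) (hbd : G₁.Adj b d)
    (ha : orient (f x) (f y) (f a) < 0) (hb : orient (f y) (f x) (f b) < 0)
    (hd : 0 < orient (f b) (f y) (f d)) (hyab : 0 < orient (f a) (f y) (f b))
    (hxab : 0 < orient (f a) (f x) (f b)) (hda : orient (f b) (f d) (f a) < 0) :
    HasThreeDisjointEdges G f := by
  obtain ⟨z, hz, hdz⟩ := h₁ d b hbd.symm
  have hy : orient (f b) (f d) (f y) < 0 := by rw [orient_swap_right]; linarith
  have hz' : 0 < orient (f b) (f d) (f z) := by rw [orient_swap]; linarith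
  have hx : orient (f b) (f d) (f x) < 0 := by
    have h := orient_barycentric (f b) (f d) (f a) (f y) (f b) (f x)
    rw [orient_self_left] at h
    have e1 : orient (f y) (f b) (f x) = -orient (f y) (f x) (f b) := orient_swap_right _ _ _
    have e2 : orient (f b) (f a) (f x) = orient (f a) (f x) (f b) :=
      (orient_rotate _ _ _).symm
    rw [e1, e2] at h
    have p1 := mul_neg_of_pos_of_neg (neg_pos.2 hb) hda
    have p2 := mul_neg_of_pos_of_neg hxab hy
    by_contra! hn
    have p3 := mul_nonneg hyab.le hn
    linarith
  refine ⟨d, z, y, b, x, a, hz, hyb, hxa, ?_, ?_, ?_⟩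
  · refine (disjoint_segment_of_orient (u := f b) (v := f d) hy (by simp) (by simp) hz' ?_).symm
    exact fun e => hbd.ne (hf.1 e)
  · refine (disjoint_segment_of_orient (u := f b) (v := f d) hx hda.le (by simp) hz' ?_).symm
    intro e
    rw [e] at hda
    simp at hda
  · rw [segment_symm ℝ (f x)]
    refine (disjoint_segment_of_orient (u := f x) (v := f y) ha (by simp) (by simp) ?_ ?_).symm
    · rw [orient_swap]; linarith
    · intro e
      rw [e] at ha
      simp at ha

/-- The zigzag `c a x y b d`, in case `c` lies on the same side of `x y` as `b`. -/
lemma HasThreeDisjointEdges.of_zigzag (hf : IsDrawing G f) (h₁ : HasTurns (-1) f G G₁)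
    (hle₁ : G₁ ≤ G) (h₂ : HasTurns 1 f G₁ G₂) (hle₂ : G₂ ≤ G₁) {x y a b c d : V}
    (hxy : G₂.Adj x y) (hxa : G₂.Adj x a) (hyb : G₂.Adj y b) (hac : G₁.Adj a c)
    (hbd : G₁.Adj b d) (ha : orient (f x) (f y) (f a) < 0)
    (hb : orient (f y) (f x) (f b) < 0) (hc : 0 < orient (f a) (f x) (f c))
    (hd : 0 < orient (f b) (f y) (f d))
    (hcd : ¬ Disjoint (segment ℝ (f a) (f c)) (segment ℝ (f b) (f d)))
    (hxyc : 0 < orient (f x) (f y) (f c)) :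
    HasThreeDisjointEdges G f := by
  have hle := hle₂.trans hle₁
  have hb' : 0 < orient (f x) (f y) (f b) := by rw [orient_swap]; linarith
  have hacx : orient (f a) (f c) (f x) < 0 := by rw [orient_swap_right]; linarith
  have hacy : orient (f a) (f c) (f y) < 0 := by simp only [orient] at *; linarith
  have hab : f a ≠ f b := by
    intro e
    rw [e] at ha
    linarith
  have hxayb : Disjoint (segment ℝ (f a) (f x)) (segment ℝ (f y) (f b)) :=
    disjoint_segment_of_orient (u := f x) (v := f y) ha (by simp) (by simp) hb'
      (fun e => hxy.ne (hf.1 e))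
  rcases lt_trichotomy (orient (f a) (f c) (f b)) 0 with hacb | hacb | hacb
  · obtain ⟨z, hz, hcz⟩ := h₁ c a hac.symm
    have hz' : 0 < orient (f a) (f c) (f z) := by rw [orient_swap]; linarith
    refine ⟨c, z, a, x, y, b, hz, (hle hxa).symm, hle hyb, ?_, ?_, hxayb⟩
    · rw [segment_symm ℝ (f a)]
      exact (disjoint_segment_of_orient (u := f a) (v := f c) hacx (by simp) (by simp) hz'
        (fun e => hac.ne (hf.1 e))).symm
    · refine (disjoint_segment_of_orient (u := f a) (v := f c) hacy hacb.le (by simp) hz' ?_).symm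
      intro e
      rw [e] at hacb
      simp at hacb
  · obtain rfl : b = c := by
      by_contra hne
      exact hf.orient_ne_zero (hle₁ hac) (fun e => hab (congrArg f e).symm) hne hacb
    have hyab : 0 < orient (f a) (f y) (f b) := by rw [orient_swap_right]; linarith
    have hda : d ≠ a := by
      rintro rfl
      simp only [orient] at *
      linarith
    rcases lt_or_gt_of_ne (hf.orient_ne_zero (hle₁ hac) hda hbd.ne') with habd | habd
    · refine .of_triangle hf h₁ (hle hxa) (hle hyb) hbd ha hb hd hyab hc ?_
      rwa [orient_rotate]
    -- Now `b` lies inside the triangle `a y d`.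
    have hneg : ∀ v : V, orient (f y) (f v) (f b) < 0 → 0 ≤ orient (f y) (f v) (f a) →
        orient (f y) (f v) (f d) < 0 := by
      intro v hvb hva
      have h := orient_barycentric (f y) (f v) (f a) (f y) (f b) (f d)
      rw [orient_self_left, orient_swap (f b) (f y)] at h
      have hs := orient_sum (f a) (f y) (f b) (f d)
      rw [orient_swap (f b) (f y), orient_swap (f a) (f b)] at hs
      have p1 := mul_nonneg hd.le hva
      have p2 := mul_neg_of_pos_of_neg
        (show 0 < orient (f a) (f y) (f d) by linarith) hvb
      by_contra! hn
      have p3 := mul_nonneg hyab.le hn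
      linarith
    have hxyd : 0 < orient (f x) (f y) (f d) := by
      have h := hneg x hb (by rw [orient_swap]; linarith)
      rw [orient_swap]
      linarith
    obtain ⟨t, hyt, ht⟩ := h₂ y x hxy.symm
    obtain ⟨z, htz, hz⟩ := h₁ t y hyt.symm
    have hxyt : orient (f x) (f y) (f t) < 0 := by rw [orient_swap]; linarith
    have hytx : orient (f y) (f t) (f x) < 0 := by rw [orient_swap_right]; linarith
    have hytz : 0 < orient (f y) (f t) (f z) := by rw [orient_swap]; linarith
    have hxybd : Disjoint (segment ℝ (f x) (f y)) (segment ℝ (f b) (f d)) := by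
      refine disjoint_segment_of_orient (u := f b) (v := f y) ?_ (by simp) (by simp) hd
        (fun e => hyb.ne (hf.1 e))
      rwa [← orient_rotate]
    have hxabd : Disjoint (segment ℝ (f x) (f a)) (segment ℝ (f b) (f d)) :=
      disjoint_segment_of_orient (u := f a) (v := f b) hacx (by simp) (by simp) habd hab
    by_cases hdisj : Disjoint (segment ℝ (f y) (f t)) (segment ℝ (f x) (f a))
    · refine ⟨y, t, x, a, b, d, hle₁ hyt, hle hxa, hle₁ hbd, hdisj, ?_, hxabd⟩
      rw [segment_symm ℝ (f y)]
      exact disjoint_segment_of_orient (u := f x) (v := f y) hxyt (by simp) hb'.le hxyd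
        (fun e => hyb.ne (hf.1 e))
    · have hyta : 0 ≤ orient (f y) (f t) (f a) := by
        by_contra! hn
        exact hdisj (disjoint_segment_of_orient_neg hytx hn (by simp) (by simp)).symm
      have hytb : orient (f y) (f t) (f b) < 0 := by
        have h := orient_barycentric (f y) (f t) (f a) (f y) (f b) (f x)
        rw [orient_self_left, orient_swap_right (f y) (f x) (f b)] at h
        have e : orient (f a) (f y) (f x) = - orient (f x) (f y) (f a) := by
          simp only [orient]; ring
        rw [e] at h
        have p1 := mul_nonneg (neg_pos.2 hb).le hyta
        have p2 := mul_neg_of_pos_of_neg hyab hytx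
        by_contra! hn
        have p3 := mul_nonneg (neg_pos.2 ha).le hn
        linarith
      refine ⟨x, y, b, d, t, z, hle hxy, hle₁ hbd, htz, hxybd, ?_, ?_⟩
      · exact disjoint_segment_of_orient (u := f y) (v := f t) hytx (by simp) (by simp) hytz
          (fun e => hyt.ne (hf.1 e))
      · exact disjoint_segment_of_orient_neg hytb (hneg t hytb hyta) (by simp) hytz.le
  · have hyab : 0 < orient (f a) (f y) (f b) := by
      by_contra! hn
      have h := orient_barycentric (f x) (f y) (f a) (f y) (f c) (f b)
      have hs := orient_sum (f a) (f y) (f c) (f b)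
      rw [orient_self_right, orient_swap (f a) (f c)] at h
      rw [orient_swap (f a) (f c)] at hs
      rw [orient_swap_right] at hacy
      have hw : 0 < orient (f y) (f c) (f b) := by linarith
      have p1 := mul_neg_of_pos_of_neg hw ha
      have p2 := mul_nonpos_of_nonpos_of_nonneg hn hxyc.le
      have p3 := mul_pos (neg_lt_zero.1 hacy) hb'
      linarith
    have hayc : 0 < orient (f a) (f y) (f c) := by rw [orient_swap_right]; linarith
    have hayx : 0 < orient (f a) (f y) (f x) := by simp only [orient] at *; linarith
    have hxab : 0 < orient (f a) (f x) (f b) := by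
      have h := orient_plucker (f a) (f y) (f x) (f c) (f b)
      have p1 := mul_pos hayx hacb
      have p2 := mul_pos hyab hc
      exact pos_of_mul_pos_right (by linarith) hayc.le
    have hacd : orient (f a) (f c) (f d) ≤ 0 := by
      by_contra! hn
      refine hcd (disjoint_segment_of_orient_neg (u := f c) (v := f a) ?_ ?_ ?_ ?_).symm
      all_goals simp [orient_swap (f a) (f c), *]
    have hda : orient (f b) (f d) (f a) < 0 := by
      by_contra! hn
      have h := orient_barycentric (f a) (f c) (f a) (f y) (f b) (f d)
      have hs := orient_sum (f a) (f y) (f b) (f d)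
      rw [orient_self_left] at h
      rw [orient_swap_right (f b) (f d)] at h hs
      rw [orient_swap (f b) (f y)] at hs
      have p1 := mul_nonneg_of_nonpos_of_nonpos (neg_nonpos.2 hn) hacy.le
      have p2 := mul_pos (show 0 < orient (f a) (f y) (f d) by linarith) hacb
      have p3 := mul_nonpos_of_nonneg_of_nonpos hyab.le hacd
      linarith
    exact .of_triangle hf h₁ (hle hxa) (hle hyb) hbd ha hb hd hyab hxab hda

lemma HasThreeDisjointEdges.of_three_hasTurns (hf : IsDrawing G f) (h₁ : HasTurns (-1) f G G₁)
    (hle₁ : G₁ ≤ G) (h₂ : HasTurns 1 f G₁ G₂) (hle₂ : G₂ ≤ G₁) {G₃ : SimpleGraph V}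
    (h₃ : HasTurns (-1) f G₂ G₃) (hle₃ : G₃ ≤ G₂) {x y : V} (hxy : G₃.Adj x y) :
    HasThreeDisjointEdges G f := by
  have hle := hle₂.trans hle₁
  obtain ⟨a, hxa, ha⟩ := h₃ x y hxy
  obtain ⟨b, hyb, hb⟩ := h₃ y x hxy.symm
  obtain ⟨c, hac, hc⟩ := h₂ a x hxa.symm
  obtain ⟨d, hbd, hd⟩ := h₂ b y hyb.symm
  replace hxy := hle₃ hxy
  replace ha : orient (f x) (f y) (f a) < 0 := by linarith
  replace hb : orient (f y) (f x) (f b) < 0 := by linarith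
  replace hc : 0 < orient (f a) (f x) (f c) := by linarith
  replace hd : 0 < orient (f b) (f y) (f d) := by linarith
  by_cases hcd : Disjoint (segment ℝ (f a) (f c)) (segment ℝ (f b) (f d))
  · refine ⟨a, c, b, d, x, y, hle₁ hac, hle₁ hbd, hle hxy, hcd, ?_, ?_⟩
    · rw [segment_symm ℝ (f x)]
      refine (disjoint_segment_of_orient (u := f a) (v := f x) ?_ (by simp) (by simp) hc
        (fun e => hxa.ne (hf.1 e))).symm
      rwa [orient_rotate (f y), orient_rotate (f x)]
    · refine (disjoint_segment_of_orient (u := f b) (v := f y) ?_ (by simp) (by simp) hd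
        (fun e => hyb.ne (hf.1 e))).symm
      rwa [← orient_rotate]
  · by_cases hxyc : 0 < orient (f x) (f y) (f c)
    · exact .of_zigzag hf h₁ hle₁ h₂ hle₂ hxy hxa hyb hac hbd ha hb hc hd hcd hxyc
    by_cases hxyd : 0 < orient (f y) (f x) (f d)
    · exact .of_zigzag hf h₁ hle₁ h₂ hle₂ hxy.symm hyb hxa hbd hac hb ha hd hc
        (fun h => hcd h.symm) hxyd
    have hcx : c ≠ x := by
      rintro rfl
      simp at hc
    have hcy : c ≠ y := by
      rintro rfl
      simp only [orient] at *
      linarith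
    have hc0 := hf.orient_ne_zero (hle hxy) hcx hcy
    have hb' := orient_swap (f x) (f y) (f b)
    have hd' := orient_swap (f x) (f y) (f d)
    exact absurd (disjoint_segment_of_orient_neg ha (lt_of_le_of_ne (not_lt.1 hxyc) hc0)
      (by linarith) (by linarith)) hcd

end Drawing

theorem stmt4 (n : ℕ) (G : SimpleGraph (Fin n)) (f : Fin n → ℝ × ℝ)
    (hf : IsDrawing G f) (hE : 3 * n + 1 ≤ G.edgeSet.ncard) :
    ∃ u₁ v₁ u₂ v₂ u₃ v₃ : Fin n,
      G.Adj u₁ v₁ ∧ G.Adj u₂ v₂ ∧ G.Adj u₃ v₃ ∧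
      s(u₁, v₁) ≠ s(u₂, v₂) ∧ s(u₁, v₁) ≠ s(u₃, v₃) ∧ s(u₂, v₂) ≠ s(u₃, v₃) ∧
      DisconnectedEdges f u₁ v₁ u₂ v₂ ∧ DisconnectedEdges f u₁ v₁ u₃ v₃ ∧
      DisconnectedEdges f u₂ v₂ u₃ v₃ := by
  have hfin : HasThreeDisjointEdges G f := by
    obtain ⟨G₁, hle₁, h₁, hn₁⟩ := hf.exists_hasTurns (σ := -1) (by norm_num)
    have hf₁ := hf.anti hle₁
    obtain ⟨G₂, hle₂, h₂, hn₂⟩ := hf₁.exists_hasTurns (σ := 1) one_ne_zero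
    obtain ⟨G₃, hle₃, h₃, hn₃⟩ := (hf₁.anti hle₂).exists_hasTurns (σ := -1) (by norm_num)
    rw [Fintype.card_fin] at hn₁ hn₂ hn₃
    obtain ⟨e, he⟩ : G₃.edgeSet.Nonempty := by
      rw [Set.nonempty_iff_ne_empty]
      intro h
      rw [h, Set.ncard_empty] at hn₃
      omega
    induction e using Sym2.ind with
    | h x y =>
      exact .of_three_hasTurns hf h₁ hle₁ h₂ hle₂ h₃ hle₃ he
  obtain ⟨u₁, v₁, u₂, v₂, u₃, v₃, e₁, e₂, e₃, h₁₂, h₁₃, h₂₃⟩ := hfin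
  have hne : ∀ {u v x y : Fin n}, DisconnectedEdges f u v x y → s(u, v) ≠ s(x, y) := by
    rintro u v x y ⟨_, h1, h2, _, _⟩ h
    rcases Sym2.eq_iff.1 h with h | h
    · exact h1 h.1
    · exact h2 h.1
  have d₁₂ := disconnectedEdges_of_disjoint h₁₂
  have d₁₃ := disconnectedEdges_of_disjoint h₁₃
  have d₂₃ := disconnectedEdges_of_disjoint h₂₃
  exact ⟨u₁, v₁, u₂, v₂, u₃, v₃, e₁, e₂, e₃, hne d₁₂, hne d₁₃, hne d₂₃, d₁₂, d₁₃, d₂₃⟩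
end
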